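/- arXiv:2311.12055 — 10 statements merged into one kernel-verified Lean document; each statement's English description precedes it below -/
import Mathlib

section
/- Fix r > 0, λ ≥ 0, μ_d ∈ ℝ and σ_d > 0 with r_d := r − μ_d − σ_d²/2 > 0. Set m₁ := (−μ_d − √(μ_d² + 2(r+λ)σ_d²))/σ_d² and m₂ := (−μ_d + √(μ_d² + 2(r+λ)σ_d²))/σ_d², and define B₁ := (m₁μ_d + m₁σ_d²/2 − r − λ)/((r+λ)(r_d+λ)(m₂ − m₁)) and C₁ := (m₂μ_d + m₂σ_d²/2 − r − λ)/((r+λ)(r_d+λ)(m₂ − m₁)). Then B₁ < 0 and C₁ < 0. -/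
/-- The coefficients B₁ and C₁ of the closed-form incentive function are negative. -/
theorem stmt_2 (r lam mud sigd : ℝ) (hr : 0 < r) (hlam : 0 ≤ lam) (hsigd : 0 < sigd)
    (hrd : 0 < r - mud - sigd ^ 2 / 2)
    (m1 m2 B1 C1 : ℝ)
    (hm1 : m1 = (-mud - Real.sqrt (mud ^ 2 + 2 * (r + lam) * sigd ^ 2)) / sigd ^ 2)
    (hm2 : m2 = (-mud + Real.sqrt (mud ^ 2 + 2 * (r + lam) * sigd ^ 2)) / sigd ^ 2)
    (hB1 : B1 = (m1 * mud + m1 * sigd ^ 2 / 2 - r - lam) /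
        ((r + lam) * ((r - mud - sigd ^ 2 / 2) + lam) * (m2 - m1)))
    (hC1 : C1 = (m2 * mud + m2 * sigd ^ 2 / 2 - r - lam) /
        ((r + lam) * ((r - mud - sigd ^ 2 / 2) + lam) * (m2 - m1))) :
    B1 < 0 ∧ C1 < 0 := by
  have hs : 0 < sigd ^ 2 := by positivity
  have hrho : 0 < r + lam := by linarith
  have hdisc : 0 ≤ mud ^ 2 + 2 * (r + lam) * sigd ^ 2 := by positivity
  have hsq := Real.sq_sqrt hdisc
  have hlt : sigd ^ 2 + mud < √(mud ^ 2 + 2 * (r + lam) * sigd ^ 2) :=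
    Real.lt_sqrt_of_sq_lt (by nlinarith [mul_pos hs hrd, mul_nonneg hs.le hlam])
  have hneg : -mud < √(mud ^ 2 + 2 * (r + lam) * sigd ^ 2) :=
    Real.lt_sqrt_of_sq_lt (by nlinarith [mul_pos hs hrho])
  generalize √(mud ^ 2 + 2 * (r + lam) * sigd ^ 2) = D at *
  have hm1_neg : m1 < 0 := by
    rw [hm1]
    exact div_neg_of_neg_of_pos (by linarith) hs
  have hm2_gt : 1 < m2 := by
    rw [hm2, one_lt_div hs]
    linarith
  rw [eq_div_iff hs.ne'] at hm1 hm2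
  -- Both `m1` and `m2` are roots of `sigd ^ 2 / 2 * m ^ 2 + mud * m - (r + lam)`.
  have root (m : ℝ) (hm : (m * sigd ^ 2 + mud) ^ 2 = D ^ 2) :
      m * mud + m * sigd ^ 2 / 2 - r - lam = sigd ^ 2 / 2 * (m * (1 - m)) := by
    apply mul_left_cancel₀ hs.ne'
    linear_combination (hm + hsq) / 2
  have hden : 0 < (r + lam) * ((r - mud - sigd ^ 2 / 2) + lam) * (m2 - m1) :=
    mul_pos (mul_pos hrho (by linarith)) (by linarith)
  rw [hB1, hC1, root m1 (by rw [hm1]; ring), root m2 (by rw [hm2]; ring)]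
  exact ⟨div_neg_of_neg_of_pos
      (mul_neg_of_pos_of_neg (by positivity) (mul_neg_of_neg_of_pos hm1_neg (by linarith))) hden,
    div_neg_of_neg_of_pos
      (mul_neg_of_pos_of_neg (by positivity)
        (mul_neg_of_pos_of_neg (by linarith) (by linarith))) hden⟩
end

section
/- Fix r > 0, λ ≥ 0, μ_d ∈ ℝ and σ_d > 0 with r_d := r − μ_d − σ_d²/2 > 0. Set m₁ := (−μ_d − √(μ_d² + 2(r+λ)σ_d²))/σ_d² and m₂ := (−μ_d + √(μ_d² + 2(r+λ)σ_d²))/σ_d², B₁ := (m₁μ_d + m₁σ_d²/2 − r − λ)/((r+λ)(r_d+λ)(m₂ − m₁)) and C₁ := (m₂μ_d + m₂σ_d²/2 − r − λ)/((r+λ)(r_d+λ)(m₂ − m₁)). Then the smooth-pasting identity B₁·(1 − m₂) = C₁·(1 − m₁) + 1/(r+λ) holds. -/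
/-- The smooth-pasting identity B₁·(1 − m₂) = C₁·(1 − m₁) + 1/(r+λ) for the
coefficients of the closed-form incentive function. -/
theorem stmt_3 (r lam mud sigd : ℝ) (hr : 0 < r) (hlam : 0 ≤ lam) (hsigd : 0 < sigd)
    (hrd : 0 < r - mud - sigd ^ 2 / 2)
    (m1 m2 B1 C1 : ℝ)
    (hm1 : m1 = (-mud - Real.sqrt (mud ^ 2 + 2 * (r + lam) * sigd ^ 2)) / sigd ^ 2)
    (hm2 : m2 = (-mud + Real.sqrt (mud ^ 2 + 2 * (r + lam) * sigd ^ 2)) / sigd ^ 2)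
    (hB1 : B1 = (m1 * mud + m1 * sigd ^ 2 / 2 - r - lam) /
        ((r + lam) * ((r - mud - sigd ^ 2 / 2) + lam) * (m2 - m1)))
    (hC1 : C1 = (m2 * mud + m2 * sigd ^ 2 / 2 - r - lam) /
        ((r + lam) * ((r - mud - sigd ^ 2 / 2) + lam) * (m2 - m1))) :
    B1 * (1 - m2) = C1 * (1 - m1) + 1 / (r + lam) := by
  have hk : 0 < r + lam := by linarith
  have hd : (r - mud - sigd ^ 2 / 2) + lam ≠ 0 := (add_pos_of_pos_of_nonneg hrd hlam).ne'
  have hsqrt : 0 < Real.sqrt (mud ^ 2 + 2 * (r + lam) * sigd ^ 2) :=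
    Real.sqrt_pos.mpr (by positivity)
  have hm : m2 - m1 ≠ 0 := by
    have hlt : m1 < m2 := by
      rw [hm1, hm2]
      gcongr
      linarith
    exact (sub_pos.mpr hlt).ne'
  have hden : (r + lam) * ((r - mud - sigd ^ 2 / 2) + lam) * (m2 - m1) ≠ 0 :=
    mul_ne_zero (mul_ne_zero hk.ne' hd) hm
  have hone : 1 / (r + lam) = ((r - mud - sigd ^ 2 / 2) + lam) * (m2 - m1) /
      ((r + lam) * ((r - mud - sigd ^ 2 / 2) + lam) * (m2 - m1)) := by
    rw [div_eq_div_iff hk.ne' hden]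
    ring
  rw [hB1, hC1, hone, div_mul_eq_mul_div, div_mul_eq_mul_div, ← add_div]
  congr 1
  ring
end

section
/- Fix r > 0, λ ≥ 0, μ_d ∈ ℝ and σ_d > 0 with r_d := r − μ_d − σ_d²/2 > 0. Set m₁ := (−μ_d − √(μ_d² + 2(r+λ)σ_d²))/σ_d² and m₂ := (−μ_d + √(μ_d² + 2(r+λ)σ_d²))/σ_d², B₁ := (m₁μ_d + m₁σ_d²/2 − r − λ)/((r+λ)(r_d+λ)(m₂ − m₁)) and C₁ := (m₂μ_d + m₂σ_d²/2 − r − λ)/((r+λ)(r_d+λ)(m₂ − m₁)). Fix y > 0 and define w : (0,∞) → ℝ by w(d) := B₁·y^{1−m₂}·d^{m₂} + d/(r_d+λ) for 0 < d < y and w(d) := C₁·y^{1−m₁}·d^{m₁} + y/(r+λ) for d ≥ y. Then w is continuously differentiable on (0,∞), twice continuously differentiable on (0,∞)∖{y}, and for every d ∈ (0,∞) with d ≠ y it satisfies the ODE (r+λ)·w(d) − (μ_d + σ_d²/2)·d·w′(d) − (σ_d²/2)·d²·w″(d) = min(d, y). -/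
open Real Set

open scoped Topology in
theorem ite_lt_eventuallyEq_left {f g : ℝ → ℝ} {x y : ℝ} (hx : x < y) :
    (fun t => if t < y then f t else g t) =ᶠ[𝓝 x] f := by
  filter_upwards [Iio_mem_nhds hx] with t ht
  exact if_pos ht

open scoped Topology in
theorem ite_lt_eventuallyEq_right {f g : ℝ → ℝ} {x y : ℝ} (hx : y < x) :
    (fun t => if t < y then f t else g t) =ᶠ[𝓝 x] g := by
  filter_upwards [Ioi_mem_nhds hx] with t ht
  exact if_neg (not_lt.mpr (le_of_lt ht))

theorem hasDerivAt_ite_lt {f g : ℝ → ℝ} {c y : ℝ} (hf : HasDerivAt f c y)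
    (hg : HasDerivAt g c y) (h : f y = g y) :
    HasDerivAt (fun t => if t < y then f t else g t) c y := by
  rw [hasDerivAt_iff_hasFDerivAt, ← hasFDerivWithinAt_univ, ← Iic_union_Ici (a := y)]
  refine HasDerivWithinAt.union (hf.hasDerivWithinAt.congr ?_ ?_) (hg.hasDerivWithinAt.congr ?_ ?_)
  · intro t ht
    rcases (mem_Iic.mp ht).lt_or_eq with ht | rfl
    · exact if_pos ht
    · simp [h]
  · simp [h]
  · intro t ht
    exact if_neg (not_lt.mpr ht)
  · simp

theorem continuousAt_ite_lt {f g : ℝ → ℝ} {y : ℝ} (hf : ContinuousAt f y)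
    (hg : ContinuousAt g y) (h : f y = g y) :
    ContinuousAt (fun t => if t < y then f t else g t) y := by
  rw [← continuousWithinAt_univ, ← Iic_union_Ici (a := y)]
  refine ContinuousWithinAt.union (hf.continuousWithinAt.congr ?_ ?_)
    (hg.continuousWithinAt.congr ?_ ?_)
  · intro t ht
    rcases (mem_Iic.mp ht).lt_or_eq with ht | rfl
    · exact if_pos ht
    · simp [h]
  · simp [h]
  · intro t ht
    exact if_neg (not_lt.mpr ht)
  · simp

/-- Two functions that are `C¹` on `(0, ∞)` and agree to first order at `y` glue to a `C¹`
function. -/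
theorem contDiffOn_one_ite_lt {f g f' g' : ℝ → ℝ} {y : ℝ}
    (hf : ∀ x, 0 < x → HasDerivAt f (f' x) x) (hg : ∀ x, 0 < x → HasDerivAt g (g' x) x)
    (hf' : ∀ x, 0 < x → ContinuousAt f' x) (hg' : ∀ x, 0 < x → ContinuousAt g' x)
    (h : f y = g y) (h' : f' y = g' y) :
    ContDiffOn ℝ 1 (fun t => if t < y then f t else g t) (Ioi 0) := by
  have hd : ∀ x ∈ Ioi (0 : ℝ), HasDerivAt (fun t => if t < y then f t else g t)
      (if x < y then f' x else g' x) x := by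
    intro x hx
    rcases lt_trichotomy x y with hxy | rfl | hxy
    · rw [if_pos hxy]
      exact (hf x hx).congr_of_eventuallyEq (ite_lt_eventuallyEq_left hxy)
    · rw [if_neg (lt_irrefl x)]
      exact hasDerivAt_ite_lt (h' ▸ hf x hx) (hg x hx) h
    · rw [if_neg hxy.not_gt]
      exact (hg x hx).congr_of_eventuallyEq (ite_lt_eventuallyEq_right hxy)
  rw [show (1 : WithTop ℕ∞) = 0 + 1 by simp, contDiffOn_succ_iff_deriv_of_isOpen isOpen_Ioi]
  refine ⟨fun x hx => (hd x hx).differentiableAt.differentiableWithinAt, by simp, ?_⟩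
  rw [contDiffOn_zero]
  refine ContinuousOn.congr (f := fun x => if x < y then f' x else g' x) (fun x hx => ?_)
    (fun x hx => (hd x hx).deriv)
  refine ContinuousAt.continuousWithinAt ?_
  rcases lt_trichotomy x y with hxy | rfl | hxy
  · exact (hf' x hx).congr (ite_lt_eventuallyEq_left hxy).symm
  · exact continuousAt_ite_lt (hf' x hx) (hg' x hx) h'
  · exact (hg' x hx).congr (ite_lt_eventuallyEq_right hxy).symm

theorem hasDerivAt_const_mul_rpow_add (A m k b : ℝ) {x : ℝ} (hx : 0 < x) :
    HasDerivAt (fun t => A * t ^ m + k * t + b) (A * (m * x ^ (m - 1)) + k) x := by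
  have := ((hasDerivAt_rpow_const (p := m) (Or.inl hx.ne')).const_mul A).add
    ((hasDerivAt_id x).const_mul k) |>.add_const b
  simpa using this

theorem contDiffAt_const_mul_rpow_add (A m k b : ℝ) (n : WithTop ℕ∞) {x : ℝ} (hx : 0 < x) :
    ContDiffAt ℝ n (fun t => A * t ^ m + k * t + b) x := by
  have := contDiffAt_rpow_const_of_ne (p := m) (n := n) hx.ne'
  fun_prop

theorem hasDerivAt_deriv_const_mul_rpow_add (A m k b : ℝ) {x : ℝ} (hx : 0 < x) :
    HasDerivAt (deriv fun t => A * t ^ m + k * t + b)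
      (A * (m * ((m - 1) * x ^ (m - 1 - 1)))) x := by
  have h := ((hasDerivAt_rpow_const (p := m - 1) (Or.inl hx.ne')).const_mul m).const_mul A
    |>.add_const k
  refine h.congr_of_eventuallyEq ?_
  filter_upwards [Ioi_mem_nhds hx] with t ht
  exact (hasDerivAt_const_mul_rpow_add A m k b ht).deriv

/-- The Euler operator annihilates `t ^ m` when `m` is a characteristic root. -/
theorem euler_operator_const_mul_rpow_add (A m k b R a c : ℝ) {x : ℝ} (hx : 0 < x)
    (hm : R - a * m - c * (m * (m - 1)) = 0) {w : ℝ → ℝ}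
    (hw : w =ᶠ[nhds x] fun t => A * t ^ m + k * t + b) :
    R * w x - a * x * deriv w x - c * x ^ 2 * deriv (deriv w) x = (R - a) * k * x + R * b := by
  rw [hw.eq_of_nhds, hw.deriv_eq, hw.deriv.deriv_eq,
    (hasDerivAt_const_mul_rpow_add A m k b hx).deriv,
    (hasDerivAt_deriv_const_mul_rpow_add A m k b hx).deriv]
  simp only [rpow_sub_one hx.ne']
  field_simp
  linear_combination A * x ^ m * hm

/-- The closed-form incentive function w (as a function of the demand d, at fixed
aggregate capacity y > 0) is C¹ on (0,∞), C² on (0,∞)∖{y}, and away from d = y it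
satisfies the ODE (r+λ)w(d) − (μ_d + σ_d²/2) d w′(d) − (σ_d²/2) d² w″(d) = min(d, y). -/
theorem stmt_4 (r lam mud sigd : ℝ) (hr : 0 < r) (hlam : 0 ≤ lam) (hsigd : 0 < sigd)
    (hrd : 0 < r - mud - sigd ^ 2 / 2)
    (m1 m2 B1 C1 : ℝ)
    (hm1 : m1 = (-mud - Real.sqrt (mud ^ 2 + 2 * (r + lam) * sigd ^ 2)) / sigd ^ 2)
    (hm2 : m2 = (-mud + Real.sqrt (mud ^ 2 + 2 * (r + lam) * sigd ^ 2)) / sigd ^ 2)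
    (hB1 : B1 = (m1 * mud + m1 * sigd ^ 2 / 2 - r - lam) /
        ((r + lam) * ((r - mud - sigd ^ 2 / 2) + lam) * (m2 - m1)))
    (hC1 : C1 = (m2 * mud + m2 * sigd ^ 2 / 2 - r - lam) /
        ((r + lam) * ((r - mud - sigd ^ 2 / 2) + lam) * (m2 - m1)))
    (y : ℝ) (hy : 0 < y)
    (w : ℝ → ℝ)
    (hw : ∀ d : ℝ, w d =
      if d < y then B1 * y ^ (1 - m2) * d ^ m2 + d / ((r - mud - sigd ^ 2 / 2) + lam)
      else C1 * y ^ (1 - m1) * d ^ m1 + y / (r + lam)) :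
    ContDiffOn ℝ 1 w (Ioi 0) ∧
    ContDiffOn ℝ 2 w (Ioi 0 \ {y}) ∧
    (∀ d ∈ Ioi (0 : ℝ), d ≠ y →
      (r + lam) * w d - (mud + sigd ^ 2 / 2) * d * deriv w d
        - sigd ^ 2 / 2 * d ^ 2 * deriv (deriv w) d = min d y) := by
  set rd : ℝ := r - mud - sigd ^ 2 / 2 with hrd_def
  set S : ℝ := √(mud ^ 2 + 2 * (r + lam) * sigd ^ 2) with hS
  have hs2 : 0 < sigd ^ 2 := by positivity
  have hR : 0 < r + lam := by linarith
  have hD : 0 < rd + lam := by linarith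
  have hS0 : 0 < S := by
    rw [hS]
    positivity
  have hSsq : S ^ 2 = mud ^ 2 + 2 * (r + lam) * sigd ^ 2 := by
    rw [hS]
    exact sq_sqrt (by positivity)
  have hroot1 : (r + lam) - (mud + sigd ^ 2 / 2) * m1 - sigd ^ 2 / 2 * (m1 * (m1 - 1)) = 0 := by
    rw [hm1]
    field_simp
    linear_combination -hSsq
  have hroot2 : (r + lam) - (mud + sigd ^ 2 / 2) * m2 - sigd ^ 2 / 2 * (m2 * (m2 - 1)) = 0 := by
    rw [hm2]
    field_simp
    linear_combination -hSsq
  have hm12 : m2 - m1 ≠ 0 := by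
    rw [hm1, hm2, ← sub_div]
    exact div_ne_zero (by linarith) hs2.ne'
  have hmatch : B1 + 1 / (rd + lam) = C1 + 1 / (r + lam) := by
    rw [hB1, hC1]
    field_simp
    rw [hrd_def]
    ring
  have hmatch' : m2 * B1 + 1 / (rd + lam) = m1 * C1 := by
    rw [hB1, hC1]
    field_simp
    ring
  have hpow : ∀ m : ℝ, y ^ (1 - m) * y ^ m = y := fun m => by
    rw [← rpow_add hy, sub_add_cancel, rpow_one]
  have hweq : w = fun d => if d < y
      then B1 * y ^ (1 - m2) * d ^ m2 + 1 / (rd + lam) * d + 0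
      else C1 * y ^ (1 - m1) * d ^ m1 + 0 * d + y / (r + lam) := by
    funext d
    rw [hw d]
    congr 1 <;> ring
  have hleft : ∀ d < y, w =ᶠ[nhds d]
      fun t => B1 * y ^ (1 - m2) * t ^ m2 + 1 / (rd + lam) * t + 0 := fun d hd =>
    hweq ▸ ite_lt_eventuallyEq_left hd
  have hright : ∀ d, y < d → w =ᶠ[nhds d]
      fun t => C1 * y ^ (1 - m1) * t ^ m1 + 0 * t + y / (r + lam) := fun d hd =>
    hweq ▸ ite_lt_eventuallyEq_right hd
  have hcont : ∀ A m k x : ℝ, 0 < x → ContinuousAt (fun t => A * (m * t ^ (m - 1)) + k) x := by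
    intro A m k x hx
    have := continuousAt_rpow_const x (m - 1) (Or.inl hx.ne')
    fun_prop
  refine ⟨?_, ?_, ?_⟩
  · rw [hweq]
    refine contDiffOn_one_ite_lt (fun x hx => hasDerivAt_const_mul_rpow_add _ _ _ _ hx)
      (fun x hx => hasDerivAt_const_mul_rpow_add _ _ _ _ hx) (hcont _ _ _) (hcont _ _ _) ?_ ?_
    · linear_combination B1 * hpow m2 - C1 * hpow m1 + y * hmatch
    · have hpow' : ∀ m : ℝ, y ^ (1 - m) * y ^ (m - 1) = 1 := fun m => by
        rw [← rpow_add hy]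
        simp
      linear_combination B1 * m2 * hpow' m2 - C1 * m1 * hpow' m1 + hmatch'
  · rintro d ⟨hd, hdy⟩
    refine ContDiffAt.contDiffWithinAt ?_
    rcases lt_or_gt_of_ne hdy with h | h
    · exact (contDiffAt_const_mul_rpow_add _ _ _ _ 2 hd).congr_of_eventuallyEq (hleft d h)
    · exact (contDiffAt_const_mul_rpow_add _ _ _ _ 2 hd).congr_of_eventuallyEq (hright d h)
  · intro d hd hdy
    rcases lt_or_gt_of_ne hdy with h | h
    · rw [min_eq_left h.le,
        euler_operator_const_mul_rpow_add _ _ _ _ _ _ _ hd hroot2 (hleft d h)]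
      field_simp
      rw [hrd_def]
      ring
    · rw [min_eq_right h.le,
        euler_operator_const_mul_rpow_add _ _ _ _ _ _ _ hd hroot1 (hright d h)]
      field_simp
      ring
end

section
/- Fix r > 0, λ ≥ 0, μ_d ∈ ℝ and σ_d > 0 with r_d := r − μ_d − σ_d²/2 > 0, and define m₁, m₂, B₁, C₁ and, for fixed y > 0, the function w(d) := B₁·y^{1−m₂}·d^{m₂} + d/(r_d+λ) for 0 < d < y and w(d) := C₁·y^{1−m₁}·d^{m₁} + y/(r+λ) for d ≥ y. Then w is monotone increasing and concave on (0,∞), satisfies 0 ≤ w(d) ≤ y/(r+λ) for all d > 0, and w(d) → y/(r+λ) as d → ∞. -/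
open Real Set Filter

/-- Gluing two differentiable functions with equal values and derivatives at `y`. -/
lemma hasDerivAt_ite_lt_s5 {f₁ f₂ f₁' f₂' : ℝ → ℝ} {y x : ℝ}
    (h₁ : HasDerivAt f₁ (f₁' x) x) (h₂ : HasDerivAt f₂ (f₂' x) x)
    (hf : f₁ y = f₂ y) (hf' : f₁' y = f₂' y) :
    HasDerivAt (fun d => if d < y then f₁ d else f₂ d) (if x < y then f₁' x else f₂' x) x := by
  rcases lt_trichotomy x y with hxy | rfl | hxy
  · rw [if_pos hxy]
    refine h₁.congr_of_eventuallyEq ?_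
    filter_upwards [Iio_mem_nhds hxy] with d hd
    exact if_pos hd
  · rw [if_neg (lt_irrefl x)]
    rw [hf'] at h₁
    have hl : HasDerivWithinAt (fun d => if d < x then f₁ d else f₂ d) (f₂' x) (Iic x) x := by
      refine h₁.hasDerivWithinAt.congr (fun d hd => ?_) (by simp [hf])
      rcases (mem_Iic.1 hd).lt_or_eq with h | rfl
      · exact if_pos h
      · simp [hf]
    have hr : HasDerivWithinAt (fun d => if d < x then f₁ d else f₂ d) (f₂' x) (Ici x) x :=
      h₂.hasDerivWithinAt.congr (fun d hd => if_neg (not_lt.2 hd)) (by simp)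
    simpa [Iic_union_Ici] using hl.union hr
  · rw [if_neg hxy.not_gt]
    refine h₂.congr_of_eventuallyEq ?_
    filter_upwards [Ioi_mem_nhds hxy] with d hd
    exact if_neg (not_lt.2 (le_of_lt hd))

/-- Gluing two antitone functions with equal values at `y`. -/
lemma AntitoneOn.ite_lt {g₁ g₂ : ℝ → ℝ} {s : Set ℝ} {y : ℝ} (hy : y ∈ s)
    (h₁ : AntitoneOn g₁ s) (h₂ : AntitoneOn g₂ s) (h : g₁ y = g₂ y) :
    AntitoneOn (fun d => if d < y then g₁ d else g₂ d) s := by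
  intro a ha b hb hab
  dsimp only
  split_ifs with hb' ha' ha'
  · exact h₁ ha hb hab
  · exact absurd (hab.trans_lt hb') ha'
  · exact (h₂ hy hb (not_lt.1 hb')).trans (h ▸ h₁ ha hy ha'.le)
  · exact h₂ ha hb hab

/-- The properties of the glued power function, for abstract coefficients that satisfy the
smooth-fit conditions at `y`. -/
lemma smoothFit_rpow_properties {m₁ m₂ B C p q y : ℝ} (hm₁ : m₁ < 0) (hm₂ : 1 < m₂)
    (hB : B < 0) (hC : C < 0) (h₀ : B + p = C + q) (h₁ : m₂ * B + p = m₁ * C) (hy : 0 < y)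
    {w : ℝ → ℝ} (hw : w = fun d => if d < y then B * y ^ (1 - m₂) * d ^ m₂ + d * p
      else C * y ^ (1 - m₁) * d ^ m₁ + y * q) :
    MonotoneOn w (Ioi 0) ∧ ConcaveOn ℝ (Ioi 0) w ∧
      (∀ d : ℝ, 0 < d → 0 ≤ w d ∧ w d ≤ y * q) ∧ Tendsto w atTop (nhds (y * q)) := by
  have hpow : ∀ m : ℝ, y ^ (1 - m) * y ^ m = y := fun m => by
    rw [← rpow_add hy]; simp
  have hpow' : ∀ m : ℝ, y ^ (1 - m) * y ^ (m - 1) = 1 := fun m => by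
    rw [← rpow_add hy]; simp
  have hpos : ∀ m : ℝ, 0 < y ^ (1 - m) := fun m => rpow_pos_of_pos hy _
  let g₁ : ℝ → ℝ := fun d => B * y ^ (1 - m₂) * (m₂ * d ^ (m₂ - 1)) + p
  let g₂ : ℝ → ℝ := fun d => C * y ^ (1 - m₁) * (m₁ * d ^ (m₁ - 1))
  let g : ℝ → ℝ := fun d => if d < y then g₁ d else g₂ d
  have hg : g₁ y = g₂ y := by
    simp only [g₁, g₂]
    linear_combination h₁ + B * m₂ * hpow' m₂ - C * m₁ * hpow' m₁
  have hderiv : ∀ d ∈ Ioi (0 : ℝ), HasDerivAt w (g d) d := by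
    intro d hd
    have hd0 : d ≠ 0 := (mem_Ioi.1 hd).ne'
    rw [hw]
    refine hasDerivAt_ite_lt_s5 (f₁' := g₁) (f₂' := g₂) ?_ ?_ ?_ hg
    · exact ((hasDerivAt_rpow_const (p := m₂) (Or.inl hd0)).const_mul
        (B * y ^ (1 - m₂))).add (hasDerivAt_mul_const p)
    · exact ((hasDerivAt_rpow_const (p := m₁) (Or.inl hd0)).const_mul
        (C * y ^ (1 - m₁))).add_const (y * q)
    · linear_combination y * h₀ + B * hpow m₂ - C * hpow m₁
  have hanti₁ : AntitoneOn g₁ (Ioi 0) := by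
    intro a ha b hb hab
    have h := rpow_le_rpow (le_of_lt ha) hab (by linarith : 0 ≤ m₂ - 1)
    have hc : B * y ^ (1 - m₂) * m₂ ≤ 0 :=
      mul_nonpos_of_nonpos_of_nonneg (mul_neg_of_neg_of_pos hB (hpos _)).le (by linarith)
    simp only [g₁]
    nlinarith [mul_le_mul_of_nonpos_left h hc]
  have hcoef : 0 < C * y ^ (1 - m₁) * m₁ :=
    mul_pos_of_neg_of_neg (mul_neg_of_neg_of_pos hC (hpos _)) hm₁
  have hanti₂ : AntitoneOn g₂ (Ioi 0) := by
    intro a ha b hb hab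
    have h := rpow_le_rpow_of_nonpos ha hab (by linarith : m₁ - 1 ≤ 0)
    simp only [g₂]
    nlinarith [mul_le_mul_of_nonneg_left h hcoef.le]
  have hanti : AntitoneOn g (Ioi 0) := hanti₁.ite_lt hy hanti₂ hg
  have hg₂ : ∀ d ∈ Ioi (0 : ℝ), 0 ≤ g₂ d := fun d hd => by
    simp only [g₂]
    rw [← mul_assoc]
    exact mul_nonneg hcoef.le (rpow_nonneg (le_of_lt hd) _)
  have hg0 : ∀ d ∈ Ioi (0 : ℝ), 0 ≤ g d := by
    intro d hd
    simp only [g]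
    split_ifs with h
    · exact (hg ▸ hg₂ y hy).trans (hanti₁ hd hy h.le)
    · exact hg₂ d hd
  have hcont : ContinuousOn w (Ioi 0) := fun d hd =>
    (hderiv d hd).continuousAt.continuousWithinAt
  have hmono : MonotoneOn w (Ioi 0) := by
    refine monotoneOn_of_deriv_nonneg (convex_Ioi 0) hcont ?_ ?_
    · rw [interior_Ioi]
      exact fun d hd => (hderiv d hd).differentiableAt.differentiableWithinAt
    · rw [interior_Ioi]
      exact fun d hd => (hderiv d hd).deriv ▸ hg0 d hd
  have hle : ∀ d, y ≤ d → w d ≤ y * q := fun d hd => by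
    rw [hw]
    simp only [if_neg (not_lt.2 hd)]
    have := mul_nonpos_of_nonpos_of_nonneg (mul_neg_of_neg_of_pos hC (hpos m₁)).le
      (rpow_nonneg (hy.le.trans hd) m₁)
    linarith
  have hnonneg : ∀ d, 0 < d → d ≤ y → 0 ≤ w d := fun d hd hdy => by
    have hbound : 0 ≤ B * y ^ (1 - m₂) * d ^ m₂ + d * p := by
      have hg₁ : 0 ≤ g₁ d := (hg ▸ hg₂ y hy).trans (hanti₁ hd hy hdy)
      have hsplit : d ^ m₂ = d * d ^ (m₂ - 1) := by
        rw [rpow_sub_one hd.ne']; field_simp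
      have hc : 0 ≤ B * y ^ (1 - m₂) * (1 - m₂) * d ^ m₂ :=
        mul_nonneg (mul_pos_of_neg_of_neg (mul_neg_of_neg_of_pos hB (hpos _))
          (by linarith)).le (rpow_nonneg hd.le _)
      have hd₁ := mul_nonneg hd.le hg₁
      simp only [g₁] at hd₁
      rw [hsplit] at hc ⊢
      linarith
    rcases hdy.lt_or_eq with h | rfl
    · simpa only [hw, if_pos h] using hbound
    · simp only [hw, lt_irrefl, if_false]
      calc _ ≤ _ := hbound
        _ = _ := by linear_combination d * h₀ + B * hpow m₂ - C * hpow m₁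
  refine ⟨hmono, ?_, fun d hd => ⟨?_, ?_⟩, ?_⟩
  · refine AntitoneOn.concaveOn_of_deriv (convex_Ioi 0) hcont ?_ ?_
    · rw [interior_Ioi]
      exact fun d hd => (hderiv d hd).differentiableAt.differentiableWithinAt
    · rw [interior_Ioi]
      exact hanti.congr fun d hd => (hderiv d hd).deriv.symm
  · rcases le_total d y with h | h
    · exact hnonneg d hd h
    · exact (hnonneg y hy le_rfl).trans (hmono hy hd h)
  · rcases le_total d y with h | h
    · exact (hmono hd hy h).trans (hle y le_rfl)
    · exact hle d h
  · have h := tendsto_rpow_neg_atTop (neg_pos.2 hm₁)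
    rw [neg_neg] at h
    have h' := (h.const_mul (C * y ^ (1 - m₁))).add_const (y * q)
    rw [mul_zero, zero_add] at h'
    refine h'.congr' ?_
    filter_upwards [eventually_ge_atTop y] with d hd
    simp only [hw, if_neg (not_lt.2 hd)]

/-- The incentive function w (as a function of demand, at fixed capacity y > 0) is
increasing and concave on (0,∞), takes values in [0, y/(r+λ)], and tends to
y/(r+λ) as d → ∞. -/
theorem stmt_5 (r lam mud sigd : ℝ) (hr : 0 < r) (hlam : 0 ≤ lam) (hsigd : 0 < sigd)
    (hrd : 0 < r - mud - sigd ^ 2 / 2)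
    (m1 m2 B1 C1 : ℝ)
    (hm1 : m1 = (-mud - Real.sqrt (mud ^ 2 + 2 * (r + lam) * sigd ^ 2)) / sigd ^ 2)
    (hm2 : m2 = (-mud + Real.sqrt (mud ^ 2 + 2 * (r + lam) * sigd ^ 2)) / sigd ^ 2)
    (hB1 : B1 = (m1 * mud + m1 * sigd ^ 2 / 2 - r - lam) /
        ((r + lam) * ((r - mud - sigd ^ 2 / 2) + lam) * (m2 - m1)))
    (hC1 : C1 = (m2 * mud + m2 * sigd ^ 2 / 2 - r - lam) /
        ((r + lam) * ((r - mud - sigd ^ 2 / 2) + lam) * (m2 - m1)))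
    (y : ℝ) (hy : 0 < y)
    (w : ℝ → ℝ)
    (hw : ∀ d : ℝ, w d =
      if d < y then B1 * y ^ (1 - m2) * d ^ m2 + d / ((r - mud - sigd ^ 2 / 2) + lam)
      else C1 * y ^ (1 - m1) * d ^ m1 + y / (r + lam)) :
    MonotoneOn w (Ioi 0) ∧
    ConcaveOn ℝ (Ioi 0) w ∧
    (∀ d : ℝ, 0 < d → 0 ≤ w d ∧ w d ≤ y / (r + lam)) ∧
    Tendsto w atTop (nhds (y / (r + lam))) := by
  have hs : 0 < sigd ^ 2 := by positivity
  have hR : 0 < r + lam := by linarith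
  have hdisc : 0 < mud ^ 2 + 2 * (r + lam) * sigd ^ 2 := by positivity
  have hsq := Real.sq_sqrt hdisc.le
  have hsqrt := Real.sqrt_pos.2 hdisc
  set q := Real.sqrt (mud ^ 2 + 2 * (r + lam) * sigd ^ 2)
  set s := sigd ^ 2
  have hsum : mud = -(s / 2) * (m1 + m2) := by
    rw [hm1, hm2]; field_simp; ring
  have hprod : r + lam = -(s / 2) * (m1 * m2) := by
    rw [hm1, hm2]; field_simp; linarith
  have hD : r - mud - s / 2 + lam = s / 2 * ((m2 - 1) * (1 - m1)) := by
    linear_combination hprod - hsum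
  have hlt : m1 < m2 := by
    rw [hm1, hm2]
    exact div_lt_div_of_pos_right (by linarith) hs
  have hm1neg : m1 < 0 := by
    by_contra! h
    nlinarith [mul_nonneg hs.le (mul_nonneg h (h.trans hlt.le))]
  have hDpos : 0 < r - mud - s / 2 + lam := by linarith
  have hm2gt : 1 < m2 := by
    rw [hD] at hDpos
    have h := (mul_pos_iff_of_pos_right (by linarith)).1
      ((mul_pos_iff_of_pos_left (half_pos hs)).1 hDpos)
    linarith
  have hden : 0 < (r + lam) * (r - mud - s / 2 + lam) * (m2 - m1) :=
    mul_pos (mul_pos hR hDpos) (by linarith)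
  have hnumB : m1 * mud + m1 * s / 2 - r - lam = s / 2 * (m1 * (1 - m1)) := by
    linear_combination m1 * hsum - hprod
  have hnumC : m2 * mud + m2 * s / 2 - r - lam = s / 2 * (m2 * (1 - m2)) := by
    linear_combination m2 * hsum - hprod
  have hBneg : B1 < 0 := by
    rw [hB1, hnumB]
    exact div_neg_of_neg_of_pos (mul_neg_of_pos_of_neg (by positivity)
      (mul_neg_of_neg_of_pos hm1neg (by linarith))) hden
  have hCneg : C1 < 0 := by
    rw [hC1, hnumC]
    exact div_neg_of_neg_of_pos (mul_neg_of_pos_of_neg (by positivity)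
      (mul_neg_of_pos_of_neg (by linarith) (by linarith))) hden
  have hne₁ : m1 ≠ 0 := hm1neg.ne
  have hne₂ : m2 ≠ 0 := by linarith
  have hne₃ : m2 - 1 ≠ 0 := by linarith
  have hne₄ : 1 - m1 ≠ 0 := by linarith
  have hne₅ : m2 - m1 ≠ 0 := by linarith
  have hfit₀ : B1 + (r - mud - s / 2 + lam)⁻¹ = C1 + (r + lam)⁻¹ := by
    rw [hB1, hC1, hnumB, hnumC, hD, hprod]
    field_simp
    ring
  have hfit₁ : m2 * B1 + (r - mud - s / 2 + lam)⁻¹ = m1 * C1 := by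
    rw [hB1, hC1, hnumB, hnumC, hD, hprod]
    field_simp
    ring
  simp only [div_eq_mul_inv y]
  refine smoothFit_rpow_properties hm1neg hm2gt hBneg hCneg hfit₀ hfit₁ hy (funext fun d => ?_)
  rw [hw d]
  simp only [div_eq_mul_inv]
end

section
/- Fix r > 0, λ ≥ 0, μ_d ∈ ℝ and σ_d > 0 with r_d := r − μ_d − σ_d²/2 > 0, define m₁, m₂, B₁, C₁ as in the incentive function, and fix d > 0. Define W : (0,∞) → ℝ by W(y) := C₁·y^{1−m₁}·d^{m₁} + y/(r+λ) for 0 < y ≤ d and W(y) := B₁·y^{1−m₂}·d^{m₂} + d/(r_d+λ) for y > d. Then W is continuously differentiable, increasing, and concave on (0,∞), with W′(y) = C₁·(1−m₁)·d^{m₁}·y^{−m₁} + 1/(r+λ) for 0 < y < d, W′(y) = B₁·(1−m₂)·d^{m₂}·y^{−m₂} for y > d, and W′(d) = B₁·(1−m₂) = C₁·(1−m₁) + 1/(r+λ). -/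
open Real Set

/-- Two differentiable functions agreeing to first order at `d` glue to a differentiable function. -/
theorem hasDerivAt_ite_le {f g f' g' : ℝ → ℝ} {d : ℝ} {s : Set ℝ}
    (hf : ∀ y ∈ s, HasDerivAt f (f' y) y) (hg : ∀ y ∈ s, HasDerivAt g (g' y) y)
    (hfg : f d = g d) (hfg' : f' d = g' d) {y : ℝ} (hy : y ∈ s) :
    HasDerivAt (fun x => if x ≤ d then f x else g x) (if y ≤ d then f' y else g' y) y := by
  rcases lt_trichotomy y d with h | rfl | h
  · rw [if_pos h.le]
    refine (hf y hy).congr_of_eventuallyEq ?_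
    filter_upwards [Iio_mem_nhds h] with x hx
    exact if_pos (le_of_lt hx)
  · rw [if_pos le_rfl, ← hasDerivWithinAt_univ, ← Iic_union_Ici (a := y)]
    refine HasDerivWithinAt.union ?_ ?_
    · exact (hf y hy).hasDerivWithinAt.congr (fun x hx => if_pos hx) (if_pos le_rfl)
    · rw [hfg']
      refine (hg y hy).hasDerivWithinAt.congr (fun x hx => ?_) ((if_pos le_rfl).trans hfg)
      rcases eq_or_lt_of_le (mem_Ici.1 hx) with rfl | hx
      · exact (if_pos le_rfl).trans hfg
      · exact if_neg hx.not_ge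
  · rw [if_neg h.not_ge]
    refine (hg y hy).congr_of_eventuallyEq ?_
    filter_upwards [Ioi_mem_nhds h] with x hx
    exact if_neg (not_le.2 hx)

/-- A function glued at `d` from two pieces with matching values, in terms of `min` and `max`. -/
theorem ite_le_eq_min_add_max {f g : ℝ → ℝ} {d : ℝ} (hfg : f d = g d) (y : ℝ) :
    (if y ≤ d then f y else g y) = f (min y d) + g (max y d) - g d := by
  split_ifs with h
  · rw [min_eq_left h, max_eq_right h]; ring
  · rw [min_eq_right (not_le.1 h).le, max_eq_left (not_le.1 h).le, hfg]; ring

/-- The two characteristic roots of `(s / 2) m² + μ m = ρ` straddle `0` and `1`. -/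
theorem characteristic_roots {ρ mu sig m1 m2 : ℝ} (hρ : 0 < ρ) (hsig : 0 < sig)
    (hD : 0 < ρ - mu - sig ^ 2 / 2)
    (hm1 : m1 = (-mu - Real.sqrt (mu ^ 2 + 2 * ρ * sig ^ 2)) / sig ^ 2)
    (hm2 : m2 = (-mu + Real.sqrt (mu ^ 2 + 2 * ρ * sig ^ 2)) / sig ^ 2) :
    m1 < 0 ∧ 1 < m2 ∧ sig ^ 2 / 2 * m1 ^ 2 + mu * m1 = ρ ∧
      sig ^ 2 / 2 * m2 ^ 2 + mu * m2 = ρ := by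
  have hs : 0 < sig ^ 2 := by positivity
  have hq : 0 < mu ^ 2 + 2 * ρ * sig ^ 2 := by positivity
  set q := Real.sqrt (mu ^ 2 + 2 * ρ * sig ^ 2) with hqdef
  have hq2 : q ^ 2 = mu ^ 2 + 2 * ρ * sig ^ 2 := Real.sq_sqrt hq.le
  have hq0 : 0 ≤ q := Real.sqrt_nonneg _
  have hρs : 0 < ρ * sig ^ 2 := by positivity
  refine ⟨?_, ?_, ?_, ?_⟩
  · rw [hm1]
    refine div_neg_of_neg_of_pos ?_ hs
    have : -mu < q := Real.lt_sqrt_of_sq_lt (by linarith [neg_sq mu])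
    linarith
  · rw [hm2, lt_div_iff₀ hs]
    have : mu + sig ^ 2 < q := Real.lt_sqrt_of_sq_lt (by nlinarith [mul_pos hs hD])
    linarith
  · rw [hm1]; field_simp; linear_combination hq2
  · rw [hm2]; field_simp; linear_combination hq2

/-- Derivative of the `rpow` term of a power-type value function. -/
theorem hasDerivAt_const_mul_rpow_one_sub_mul (c m k : ℝ) {y : ℝ} (hy : 0 < y) :
    HasDerivAt (fun x : ℝ => c * x ^ (1 - m) * k) (c * (1 - m) * k * y ^ (-m)) y := by
  have h := ((Real.hasDerivAt_rpow_const (p := 1 - m) (Or.inl hy.ne')).const_mul c).mul_const k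
  refine h.congr_deriv ?_
  rw [show 1 - m - 1 = -m by ring]; ring

/-- The incentive function viewed as a function W of the aggregate installed
capacity y at fixed demand d > 0 is C¹, increasing and concave on (0,∞), with the
stated derivative formulas on (0,d), (d,∞) and at y = d. -/
theorem stmt_9 (r lam mud sigd : ℝ) (hr : 0 < r) (hlam : 0 ≤ lam) (hsigd : 0 < sigd)
    (hrd : 0 < r - mud - sigd ^ 2 / 2)
    (m1 m2 B1 C1 : ℝ)
    (hm1 : m1 = (-mud - Real.sqrt (mud ^ 2 + 2 * (r + lam) * sigd ^ 2)) / sigd ^ 2)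
    (hm2 : m2 = (-mud + Real.sqrt (mud ^ 2 + 2 * (r + lam) * sigd ^ 2)) / sigd ^ 2)
    (hB1 : B1 = (m1 * mud + m1 * sigd ^ 2 / 2 - r - lam) /
        ((r + lam) * ((r - mud - sigd ^ 2 / 2) + lam) * (m2 - m1)))
    (hC1 : C1 = (m2 * mud + m2 * sigd ^ 2 / 2 - r - lam) /
        ((r + lam) * ((r - mud - sigd ^ 2 / 2) + lam) * (m2 - m1)))
    (d : ℝ) (hd : 0 < d)
    (W : ℝ → ℝ)
    (hW : ∀ y : ℝ, W y =
      if y ≤ d then C1 * y ^ (1 - m1) * d ^ m1 + y / (r + lam)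
      else B1 * y ^ (1 - m2) * d ^ m2 + d / ((r - mud - sigd ^ 2 / 2) + lam)) :
    ContDiffOn ℝ 1 W (Ioi 0) ∧
    StrictMonoOn W (Ioi 0) ∧
    ConcaveOn ℝ (Ioi 0) W ∧
    (∀ y : ℝ, 0 < y → y < d →
      deriv W y = C1 * (1 - m1) * d ^ m1 * y ^ (-m1) + 1 / (r + lam)) ∧
    (∀ y : ℝ, d < y → deriv W y = B1 * (1 - m2) * d ^ m2 * y ^ (-m2)) ∧
    deriv W d = B1 * (1 - m2) ∧
    B1 * (1 - m2) = C1 * (1 - m1) + 1 / (r + lam) := by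
  have hρ : 0 < r + lam := by linarith
  have hD : 0 < r - mud - sigd ^ 2 / 2 + lam := by linarith
  obtain ⟨h1, h2, e1, e2⟩ :=
    characteristic_roots hρ hsigd (by linarith : 0 < r + lam - mud - sigd ^ 2 / 2) hm1 hm2
  have hs : 0 < sigd ^ 2 := by positivity
  have hm : 0 < m2 - m1 := by linarith
  have hden : 0 < (r + lam) * (r - mud - sigd ^ 2 / 2 + lam) * (m2 - m1) := by positivity
  have hB : B1 < 0 := by
    rw [hB1]
    refine div_neg_of_neg_of_pos ?_ hden
    nlinarith [mul_pos hs (mul_pos_of_neg_of_neg h1 (by linarith : m1 - 1 < 0))]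
  have hC : C1 < 0 := by
    rw [hC1]
    refine div_neg_of_neg_of_pos ?_ hden
    nlinarith [mul_pos hs (mul_pos (by linarith : 0 < m2) (by linarith : 0 < m2 - 1))]
  have hval : C1 + 1 / (r + lam) = B1 + 1 / (r - mud - sigd ^ 2 / 2 + lam) := by
    rw [hB1, hC1, div_add_div _ _ hden.ne' hρ.ne', div_add_div _ _ hden.ne' hD.ne',
      div_eq_div_iff (by positivity) (by positivity)]
    ring
  have hslope : B1 * (1 - m2) = C1 * (1 - m1) + 1 / (r + lam) := by
    rw [hB1, hC1, div_mul_eq_mul_div, div_mul_eq_mul_div, div_add_div _ _ hden.ne' hρ.ne',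
      div_eq_div_iff (by positivity) (by positivity)]
    ring
  clear hm1 hm2 hB1 hC1
  let f : ℝ → ℝ := fun y => C1 * y ^ (1 - m1) * d ^ m1 + y / (r + lam)
  let g : ℝ → ℝ := fun y => B1 * y ^ (1 - m2) * d ^ m2 + d / (r - mud - sigd ^ 2 / 2 + lam)
  let f' : ℝ → ℝ := fun y => C1 * (1 - m1) * d ^ m1 * y ^ (-m1) + 1 / (r + lam)
  let g' : ℝ → ℝ := fun y => B1 * (1 - m2) * d ^ m2 * y ^ (-m2)
  have hf : ∀ y ∈ Ioi (0 : ℝ), HasDerivAt f (f' y) y := fun y hy =>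
    (hasDerivAt_const_mul_rpow_one_sub_mul C1 m1 (d ^ m1) hy).add
      ((hasDerivAt_id y).div_const (r + lam))
  have hg : ∀ y ∈ Ioi (0 : ℝ), HasDerivAt g (g' y) y := fun y hy =>
    (hasDerivAt_const_mul_rpow_one_sub_mul B1 m2 (d ^ m2) hy).add_const _
  have hpow (m : ℝ) : d ^ (1 - m) * d ^ m = d := by
    rw [← Real.rpow_add hd, sub_add_cancel, Real.rpow_one]
  have hpow' (m : ℝ) : d ^ m * d ^ (-m) = 1 := by
    rw [← Real.rpow_add hd, add_neg_cancel, Real.rpow_zero]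
  have hfg : f d = g d := by
    simp only [f, g]
    linear_combination C1 * hpow m1 - B1 * hpow m2 + d * hval
  have hg'd : g' d = B1 * (1 - m2) := by
    simp only [g']
    linear_combination B1 * (1 - m2) * hpow' m2
  have hf'd : f' d = B1 * (1 - m2) := by
    simp only [f']
    linear_combination C1 * (1 - m1) * hpow' m1 - hslope
  have hfg' : f' d = g' d := hf'd.trans hg'd.symm
  have hW' : ∀ y ∈ Ioi (0 : ℝ), HasDerivAt W (if y ≤ d then f' y else g' y) y := fun y hy => by
    rw [show W = fun y => if y ≤ d then f y else g y from funext hW]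
    exact hasDerivAt_ite_le hf hg hfg hfg' hy
  have hderiv : EqOn (deriv W) (fun y => f' (min y d) + g' (max y d) - g' d) (Ioi 0) :=
    fun y hy => (hW' y hy).deriv.trans (ite_le_eq_min_add_max hfg' y)
  have hmin : MapsTo (fun y => min y d) (Ioi 0) (Ioi (0 : ℝ)) := fun y hy => lt_min hy hd
  have hmax : MapsTo (fun y => max y d) (Ioi 0) (Ioi (0 : ℝ)) := fun y _ => lt_max_of_lt_right hd
  have hcont (m : ℝ) : ContinuousOn (fun y : ℝ => y ^ m) (Ioi 0) := fun y hy =>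
    (Real.continuousAt_rpow_const y m (Or.inl (ne_of_gt hy))).continuousWithinAt
  have hf'c : ContinuousOn f' (Ioi 0) := ((hcont _).const_mul _).add continuousOn_const
  have hg'c : ContinuousOn g' (Ioi 0) := (hcont _).const_mul _
  have hcd : ContinuousOn (deriv W) (Ioi 0) :=
    (((hf'c.comp (by fun_prop) hmin).add (hg'c.comp (by fun_prop) hmax)).sub
      continuousOn_const).congr hderiv
  have hBpos : 0 < B1 * (1 - m2) := mul_pos_of_neg_of_neg hB (by linarith)
  have hf'a : AntitoneOn f' (Ioi 0) := fun x hx y _ hxy => by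
    have := Real.rpow_le_rpow (le_of_lt hx) hxy (neg_nonneg.2 h1.le)
    have hc : C1 * (1 - m1) * d ^ m1 ≤ 0 :=
      mul_nonpos_of_nonpos_of_nonneg (mul_nonpos_of_nonpos_of_nonneg hC.le (by linarith))
        (by positivity)
    have := mul_le_mul_of_nonpos_left this hc
    simp only [f']
    linarith
  have hg'a : AntitoneOn g' (Ioi 0) := fun x hx y _ hxy =>
    mul_le_mul_of_nonneg_left
      (Real.rpow_le_rpow_of_nonpos hx hxy (by linarith)) (by positivity)
  have hda : AntitoneOn (deriv W) (Ioi 0) := fun x hx y hy hxy => by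
    rw [hderiv hx, hderiv hy]
    have a := hf'a (hmin hx) (hmin hy) (min_le_min_right d hxy)
    have b := hg'a (hmax hx) (hmax hy) (max_le_max_right d hxy)
    simp only at a b ⊢
    linarith
  have hpos : ∀ y ∈ Ioi (0 : ℝ), 0 < deriv W y := fun y hy => by
    rw [hderiv hy]
    have a := hf'a (hmin hy) hd (min_le_right y d)
    have b : 0 < g' (max y d) := mul_pos (by positivity) (Real.rpow_pos_of_pos (hmax hy) _)
    simp only at a b ⊢
    linarith
  have hdiff : DifferentiableOn ℝ W (Ioi 0) := fun y hy =>
    (hW' y hy).differentiableAt.differentiableWithinAt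
  refine ⟨?_, ?_, ?_, ?_, ?_, ?_, hslope⟩
  · exact (contDiffOn_one_iff_derivWithin isOpen_Ioi.uniqueDiffOn).2
      ⟨hdiff, hcd.congr fun y hy => derivWithin_of_isOpen isOpen_Ioi hy⟩
  · exact strictMonoOn_of_deriv_pos (convex_Ioi 0) hdiff.continuousOn (by rwa [interior_Ioi])
  · exact AntitoneOn.concaveOn_of_deriv (convex_Ioi 0) hdiff.continuousOn
      (by rwa [interior_Ioi]) (by rwa [interior_Ioi])
  · intro y hy hyd
    rw [(hW' y hy).deriv, if_pos hyd.le]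
  · intro y hyd
    rw [(hW' y (hd.trans hyd)).deriv, if_neg hyd.not_ge]
  · rw [(hW' d hd).deriv, if_pos le_rfl, hf'd]
end

section
/- Fix r > 0, λ ≥ 0, μ_d ∈ ℝ, σ_d > 0 with r_d := r − μ_d − σ_d²/2 > 0, define m₁, m₂, B₁, C₁ as in the incentive function, and fix Z > 0, d > 0, g_h ∈ ℝ, θ_h > 0, β ∈ (0,1) and y_b ≥ 0. Set β_h := −g_h/(Z·B₁·(1−m₂)) and consider J̃_h(y_h) := g_h·y_h + β·Z·w(y_h + y_b, d) on [0, θ_h]. Then the following point y_h* is a maximizer of J̃_h over [0, θ_h]: y_h* = θ_h if g_h ≥ 0; y_h* = 0 if g_h + Zβ/(r+λ) ≤ 0; y_h* = max( min( d·(β/β_h)^{1/m₂} − y_b, θ_h ), 0 ) if g_h < 0 < g_h + Zβ/(r+λ) and β > β_h; and y_h* = max( min( d·((g_h/β_h + Z/(r+λ))/(g_h/β + Z/(r+λ)))^{1/m₁} − y_b, θ_h ), 0 ) if g_h < 0 < g_h + Zβ/(r+λ) and β ≤ β_h. -/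
open Real Set

/-- The two expressions for `w` on `[0, d]` and `[d, ∞)`, glued at `d`, with the coefficients
`B` and `C` chosen such that the derivative is `c₁ + c₂ - c₂ (y/d)^{-m₁}` below `d` and
`c₁ (y/d)^{-m₂}` above. -/
lemma hasDerivAt_glued_power {u : ℝ → ℝ} {m1 m2 B C c1 c2 k d : ℝ}
    (hd : 0 < d) (hB : B * (1 - m2) = c1) (hC : C * (1 - m1) = -c2)
    (hu1 : ∀ y ≤ d, u y = C * y ^ (1 - m1) * d ^ m1 + y * (c1 + c2))
    (hu2 : ∀ y, d ≤ y → u y = B * y ^ (1 - m2) * d ^ m2 + k) {y : ℝ} (hy : 0 < y) :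
    HasDerivAt u (if y ≤ d then c1 + c2 - c2 * (y / d) ^ (-m1) else c1 * (y / d) ^ (-m2)) y := by
  have pw : ∀ m : ℝ, y ^ (-m) * d ^ m = (y / d) ^ (-m) := by
    intro m
    rw [div_rpow hy.le hd.le, rpow_neg hd.le, div_inv_eq_mul]
  have h1 : HasDerivAt (fun y : ℝ => C * y ^ (1 - m1) * d ^ m1 + y * (c1 + c2))
      (c1 + c2 - c2 * (y / d) ^ (-m1)) y := by
    have := (((hasDerivAt_rpow_const (p := 1 - m1) (Or.inl hy.ne')).const_mul C).mul_const
      (d ^ m1)).add ((hasDerivAt_id y).mul_const (c1 + c2))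
    refine this.congr_deriv ?_
    rw [← pw, show 1 - m1 - 1 = -m1 by ring]
    linear_combination (y ^ (-m1) * d ^ m1) * hC
  have h2 : HasDerivAt (fun y : ℝ => B * y ^ (1 - m2) * d ^ m2 + k)
      (c1 * (y / d) ^ (-m2)) y := by
    have := (((hasDerivAt_rpow_const (p := 1 - m2) (Or.inl hy.ne')).const_mul B).mul_const
      (d ^ m2)).add_const k
    refine this.congr_deriv ?_
    rw [← pw, show 1 - m2 - 1 = -m2 by ring]
    linear_combination (y ^ (-m2) * d ^ m2) * hB
  rcases lt_trichotomy y d with h | h | h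
  · rw [if_pos h.le]
    refine h1.congr_of_eventuallyEq ?_
    filter_upwards [Iio_mem_nhds h] with x hx using hu1 x (le_of_lt hx)
  · subst h
    rw [if_pos le_rfl]
    have e : c1 * (y / y) ^ (-m2) = c1 + c2 - c2 * (y / y) ^ (-m1) := by
      rw [div_self hy.ne', one_rpow, one_rpow]; ring
    rw [e] at h2
    have l : HasDerivWithinAt u _ (Iic y) y :=
      h1.hasDerivWithinAt.congr (fun x hx => hu1 x hx) (hu1 y le_rfl)
    have g : HasDerivWithinAt u _ (Ici y) y :=
      h2.hasDerivWithinAt.congr (fun x hx => hu2 x hx) (hu2 y le_rfl)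
    have := l.union g
    rwa [Iic_union_Ici, hasDerivWithinAt_univ] at this
  · rw [if_neg (not_le.mpr h)]
    refine h2.congr_of_eventuallyEq ?_
    filter_upwards [Ioi_mem_nhds h] with x hx using hu2 x (le_of_lt hx)

/-- A continuous function increasing on `[a, x]` and decreasing on `[x, b]` is maximal at `x`. -/
lemma isMaxOn_Icc_of_deriv_sign {f f' : ℝ → ℝ} {a b x : ℝ} (hx : x ∈ Icc a b)
    (hc : ContinuousOn f (Icc a b)) (hf : ∀ y ∈ Ioo a b, HasDerivAt f (f' y) y)
    (h1 : ∀ y ∈ Ioo a x, 0 ≤ f' y) (h2 : ∀ y ∈ Ioo x b, f' y ≤ 0) :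
    IsMaxOn f (Icc a b) x := by
  intro y hy
  rcases le_total y x with h | h
  · have : MonotoneOn f (Icc a x) := by
      refine monotoneOn_of_hasDerivWithinAt_nonneg (f' := f') (convex_Icc _ _)
        (hc.mono (Icc_subset_Icc_right hx.2)) ?_ ?_ <;> rw [interior_Icc]
      · exact fun z hz => (hf z ⟨hz.1, hz.2.trans_le hx.2⟩).hasDerivWithinAt
      · exact h1
    exact this ⟨hy.1, h⟩ ⟨hx.1, le_rfl⟩ h
  · have : AntitoneOn f (Icc x b) := by
      refine antitoneOn_of_hasDerivWithinAt_nonpos (f' := f') (convex_Icc _ _)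
        (hc.mono (Icc_subset_Icc_left hx.1)) ?_ ?_ <;> rw [interior_Icc]
      · exact fun z hz => (hf z ⟨hx.1.trans_lt hz.1, hz.2⟩).hasDerivWithinAt
      · exact h2
    exact this ⟨le_rfl, hx.2⟩ ⟨h, hy.2⟩ h

/-- Household's best response: for fixed incentive share β and biogas installation
y_b, the stated point y_h* maximizes the household's reduced payoff
J̃_h(y_h) = g_h·y_h + β·Z·w(y_h + y_b, d) over [0, θ_h], in each of the four cases. -/
theorem stmt_10 (r lam mud sigd : ℝ) (hr : 0 < r) (hlam : 0 ≤ lam) (hsigd : 0 < sigd)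
    (hrd : 0 < r - mud - sigd ^ 2 / 2)
    (m1 m2 B1 C1 : ℝ)
    (hm1 : m1 = (-mud - Real.sqrt (mud ^ 2 + 2 * (r + lam) * sigd ^ 2)) / sigd ^ 2)
    (hm2 : m2 = (-mud + Real.sqrt (mud ^ 2 + 2 * (r + lam) * sigd ^ 2)) / sigd ^ 2)
    (hB1 : B1 = (m1 * mud + m1 * sigd ^ 2 / 2 - r - lam) /
        ((r + lam) * ((r - mud - sigd ^ 2 / 2) + lam) * (m2 - m1)))
    (hC1 : C1 = (m2 * mud + m2 * sigd ^ 2 / 2 - r - lam) /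
        ((r + lam) * ((r - mud - sigd ^ 2 / 2) + lam) * (m2 - m1)))
    (w : ℝ → ℝ → ℝ)
    (hw : ∀ y d : ℝ, w y d =
      if y = 0 then 0
      else if d < y then B1 * y ^ (1 - m2) * d ^ m2 + d / ((r - mud - sigd ^ 2 / 2) + lam)
      else C1 * y ^ (1 - m1) * d ^ m1 + y / (r + lam))
    (Z d gh θh β yb : ℝ) (hZ : 0 < Z) (hd : 0 < d) (hθh : 0 < θh)
    (hβ : β ∈ Set.Ioo (0 : ℝ) 1) (hyb : 0 ≤ yb)
    (βh : ℝ) (hβh : βh = -gh / (Z * B1 * (1 - m2))) :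
    (0 ≤ gh →
      IsMaxOn (fun yh => gh * yh + β * Z * w (yh + yb) d) (Icc 0 θh) θh) ∧
    (gh + Z * β / (r + lam) ≤ 0 →
      IsMaxOn (fun yh => gh * yh + β * Z * w (yh + yb) d) (Icc 0 θh) 0) ∧
    (gh < 0 → 0 < gh + Z * β / (r + lam) → βh < β →
      IsMaxOn (fun yh => gh * yh + β * Z * w (yh + yb) d) (Icc 0 θh)
        (max (min (d * (β / βh) ^ (1 / m2) - yb) θh) 0)) ∧
    (gh < 0 → 0 < gh + Z * β / (r + lam) → β ≤ βh →
      IsMaxOn (fun yh => gh * yh + β * Z * w (yh + yb) d) (Icc 0 θh)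
        (max (min (d * ((gh / βh + Z / (r + lam)) / (gh / β + Z / (r + lam))) ^ (1 / m1) - yb)
          θh) 0)) := by
  obtain ⟨hβ0, -⟩ := hβ
  set R := r + lam with hR
  have hR0 : 0 < R := by positivity
  set D := r - mud - sigd ^ 2 / 2 + lam with hD
  have hD0 : 0 < D := by positivity
  set S := √(mud ^ 2 + 2 * R * sigd ^ 2) with hS
  have hS2 : S ^ 2 = mud ^ 2 + 2 * R * sigd ^ 2 := sq_sqrt (by positivity)
  have hs2 : 0 < sigd ^ 2 := by positivity
  have hSμ : |mud| < S := by
    refine abs_lt_of_sq_lt_sq ?_ (sqrt_nonneg _)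
    rw [hS2]; have : 0 < R * sigd ^ 2 := by positivity
    linarith
  have hSlt := abs_lt.mp hSμ
  have hm1neg : m1 < 0 := by rw [hm1]; exact div_neg_of_neg_of_pos (by linarith) hs2
  have hm2pos : 0 < m2 := by rw [hm2]; exact div_pos (by linarith) hs2
  have e1 : sigd ^ 2 * m1 = -mud - S := by rw [hm1]; field_simp
  have e2 : sigd ^ 2 * m2 = -mud + S := by rw [hm2]; field_simp
  have hsum : sigd ^ 2 * (m1 + m2) = -2 * mud := by linear_combination e1 + e2
  have hprod : sigd ^ 2 * (m1 * m2) = -2 * R := by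
    refine mul_left_cancel₀ hs2.ne' ?_
    linear_combination (sigd ^ 2 * m2) * e1 + (-mud - S) * e2 - hS2
  have hD' : D = -(sigd ^ 2 / 2) * ((1 - m1) * (1 - m2)) := by
    linear_combination hsum * (-1 / 2) + hprod / 2 + hD - hR
  have hm12 : 0 < m2 - m1 := by linarith
  set c1 := -m1 / (R * (m2 - m1)) with hc1
  set c2 := m2 / (R * (m2 - m1)) with hc2
  have hc1pos : 0 < c1 := div_pos (by linarith) (by positivity)
  have hc2pos : 0 < c2 := by positivity
  have hc12 : c1 + c2 = 1 / R := by rw [hc1, hc2]; field_simp; ring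
  have n1 : m1 * mud + m1 * sigd ^ 2 / 2 - r - lam = sigd ^ 2 / 2 * (m1 * (1 - m1)) := by
    linear_combination (m1 / 2) * hsum - hprod / 2 + hR
  have n2 : m2 * mud + m2 * sigd ^ 2 / 2 - r - lam = sigd ^ 2 / 2 * (m2 * (1 - m2)) := by
    linear_combination (m2 / 2) * hsum - hprod / 2 + hR
  have hBc : B1 * (1 - m2) = c1 := by
    rw [hB1, n1, hc1, div_mul_eq_mul_div, div_eq_div_iff (by positivity) (by positivity)]
    linear_combination (m1 * R * (m2 - m1)) * hD'
  have hCc : C1 * (1 - m1) = -c2 := by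
    rw [hC1, n2, hc2, ← neg_div, div_mul_eq_mul_div, div_eq_div_iff (by positivity) (by positivity)]
    linear_combination (m2 * R * (m2 - m1)) * hD'
  have hglue : B1 + 1 / D = C1 + 1 / R := by
    rw [hB1, hC1, n1, n2]
    field_simp
    linear_combination (m2 - m1) * (2 * hD - 2 * hR + hsum)
  have hu1 : ∀ y, 0 ≤ y → y ≤ d → w y d = C1 * y ^ (1 - m1) * d ^ m1 + y * (c1 + c2) := by
    intro y hy0 hy
    rw [hw, hc12]
    split_ifs with h h'
    · rw [h, zero_rpow (by linarith)]; ring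
    · linarith
    · ring
  have hu2 : ∀ y, d ≤ y → w y d = B1 * y ^ (1 - m2) * d ^ m2 + d / D := by
    intro y hy
    rw [hw, if_neg (by linarith)]
    split_ifs with h
    · rfl
    · obtain rfl : y = d := le_antisymm (not_lt.mp h) hy
      have p : ∀ m : ℝ, y ^ (1 - m) * y ^ m = y := fun m => by
        rw [← rpow_add hd, sub_add_cancel, rpow_one]
      rw [mul_assoc, mul_assoc, p, p]
      linear_combination (-y) * hglue
  set u : ℝ → ℝ := fun y => if y ≤ d then C1 * y ^ (1 - m1) * d ^ m1 + y * (c1 + c2)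
    else w y d with hu
  have huw : ∀ y, 0 ≤ y → u y = w y d := by
    intro y hy
    simp only [hu]
    split_ifs with h
    · exact (hu1 y hy h).symm
    · rfl
  set p : ℝ → ℝ := fun y => if y ≤ d then c1 + c2 - c2 * (y / d) ^ (-m1)
    else c1 * (y / d) ^ (-m2) with hp
  have hder : ∀ y, 0 < y → HasDerivAt u (p y) y := fun y hy =>
    hasDerivAt_glued_power hd hBc hCc (fun x hx => if_pos hx)
      (fun x hx => (huw x (hd.le.trans hx)).trans (hu2 x hx)) hy
  have hcont : ContinuousOn u (Ici 0) := by
    intro y hy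
    rcases eq_or_lt_of_le (mem_Ici.mp hy) with h | h
    · subst h
      refine ContinuousAt.continuousWithinAt ?_
      have : ContinuousAt (fun y : ℝ => C1 * y ^ (1 - m1) * d ^ m1 + y * (c1 + c2)) 0 := by
        have := continuousAt_rpow_const 0 (1 - m1) (Or.inr (by linarith))
        fun_prop
      refine this.congr ?_
      filter_upwards [Iio_mem_nhds hd] with x hx using (if_pos (le_of_lt hx)).symm
    · exact (hder y h).continuousAt.continuousWithinAt
  have hplow : ∀ y, 0 < y → y ≤ d → p y = c1 + c2 - c2 * (y / d) ^ (-m1) :=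
    fun y _ h => if_pos h
  have hphigh : ∀ y, d < y → p y = c1 * (y / d) ^ (-m2) := fun y h => if_neg (not_le.mpr h)
  have hpc1 : ∀ y, 0 < y → y ≤ d → c1 ≤ p y := by
    intro y hy h
    rw [hplow y hy h]
    have : (y / d) ^ (-m1) ≤ 1 :=
      rpow_le_one (by positivity) ((div_le_one hd).mpr h) (by linarith)
    linarith [mul_le_mul_of_nonneg_left this hc2pos.le]
  have hpc1' : ∀ y, d < y → p y ≤ c1 := by
    intro y h
    rw [hphigh y h]
    have : (y / d) ^ (-m2) ≤ 1 :=
      rpow_le_one_of_one_le_of_nonpos ((one_le_div hd).mpr h.le) (by linarith)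
    exact mul_le_of_le_one_right hc1pos.le this
  have hp0 : ∀ y, 0 < y → 0 ≤ p y := by
    intro y hy
    rcases le_or_gt y d with h | h
    · exact hc1pos.le.trans (hpc1 y hy h)
    · rw [hphigh y h]; positivity
  have hpR : ∀ y, 0 < y → p y ≤ 1 / R := by
    intro y hy
    rw [← hc12]
    rcases le_or_gt y d with h | h
    · rw [hplow y hy h]
      have : 0 ≤ c2 * (y / d) ^ (-m1) := by positivity
      linarith
    · linarith [hpc1' y h]
  have hβZ : 0 < β * Z := by positivity
  have key : ∀ x ∈ Icc 0 θh, (∀ y, 0 < y → y < x + yb → yb < y → 0 ≤ gh + β * Z * p y) →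
      (∀ y, 0 < y → x + yb < y → y < θh + yb → gh + β * Z * p y ≤ 0) →
      IsMaxOn (fun yh => gh * yh + β * Z * w (yh + yb) d) (Icc 0 θh) x := by
    intro x hx h1 h2 z hz
    have hpos : ∀ y ∈ Ioo yb (θh + yb), 0 < y := fun y hy => hyb.trans_lt hy.1
    have := isMaxOn_Icc_of_deriv_sign (f := fun y => gh * y + β * Z * u y)
      (f' := fun y => gh + β * Z * p y) (a := yb) (b := θh + yb) (x := x + yb)
      ⟨by linarith [hx.1], by linarith [hx.2]⟩
      ((continuousOn_const.mul continuousOn_id).add (continuousOn_const.mul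
        (hcont.mono fun y hy => hyb.trans hy.1)))
      (fun y hy => (((hasDerivAt_id y).const_mul gh).add
        ((hder y (hpos y hy)).const_mul (β * Z))).congr_deriv (by rw [mul_one]))
      (fun y hy => h1 y (hyb.trans_lt hy.1) hy.2 hy.1)
      (fun y hy => h2 y (by linarith [hx.1, hy.1]) hy.1 hy.2)
    have hz' := this (show z + yb ∈ Icc yb (θh + yb) from
      ⟨by linarith [hz.1], by linarith [hz.2]⟩)
    simp only [mem_ofPred_eq] at hz' ⊢
    rw [huw _ (by linarith [hz.1]), huw _ (by linarith [hx.1])] at hz'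
    linarith
  have clamp : ∀ t : ℝ, (∀ y, 0 < y → y ≤ t → 0 ≤ gh + β * Z * p y) →
      (∀ y, 0 < y → t ≤ y → gh + β * Z * p y ≤ 0) →
      IsMaxOn (fun yh => gh * yh + β * Z * w (yh + yb) d) (Icc 0 θh)
        (max (min (t - yb) θh) 0) := by
    intro t h1 h2
    refine key _ ⟨le_max_right _ _, max_le (min_le_right _ _) hθh.le⟩ ?_ ?_
    · intro y hy hyx hyy
      refine h1 y hy ?_
      have : y - yb < max (min (t - yb) θh) 0 := by linarith
      rcases lt_max_iff.mp this with h | h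
      · linarith [(lt_min_iff.mp h).1]
      · linarith
    · intro y hy hyx hyy
      refine h2 y hy ?_
      have : max (min (t - yb) θh) 0 < y - yb := by linarith
      rcases min_lt_iff.mp (max_lt_iff.mp this).1 with h | h <;> linarith
  have hβh' : gh = -βh * (Z * c1) := by
    rw [hβh, mul_assoc, hBc]; field_simp
  refine ⟨fun hg => ?_, fun hg => ?_, fun hg hg' hlt => ?_, fun hg hg' hle => ?_⟩
  · refine key θh ⟨hθh.le, le_rfl⟩ ?_ ?_
    · intro y hy _ _
      have := hp0 y hy
      positivity
    · intro y _ h1 h2; linarith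
  · refine key 0 ⟨le_rfl, hθh.le⟩ ?_ ?_
    · intro y _ h1 h2; linarith
    · intro y hy _ _
      have := mul_le_mul_of_nonneg_left (hpR y hy) hβZ.le
      have e : β * Z * (1 / R) = Z * β / R := by ring
      linarith
  · have hβh0 : 0 < βh := by
      have : 0 < Z * c1 := by positivity
      exact (mul_pos_iff_of_pos_right this).mp (by linarith)
    have ht : ((β / βh) ^ (1 / m2)) ^ (-m2) = βh / β := by
      rw [← rpow_mul (by positivity), show 1 / m2 * -m2 = -1 by field_simp, rpow_neg_one, inv_div]
    set s := (β / βh) ^ (1 / m2) with hs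
    have hs1 : 1 < s := one_lt_rpow ((one_lt_div hβh0).mpr hlt) (by positivity)
    have hfoc : gh + β * Z * (c1 * (βh / β)) = 0 := by rw [hβh']; field_simp; ring
    have hk : 0 < β * Z * c1 := by positivity
    refine clamp _ ?_ ?_
    · intro y hy hyt
      rcases le_or_gt y d with h | h
      · have := mul_le_mul_of_nonneg_left (hpc1 y hy h) hβZ.le
        have : 0 < (β - βh) * (Z * c1) := mul_pos (by linarith) (by positivity)
        linarith
      · rw [hphigh y h]
        have : s ^ (-m2) ≤ (y / d) ^ (-m2) :=
          rpow_le_rpow_of_nonpos (by positivity) ((div_le_iff₀' hd).mpr hyt) (by linarith)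
        rw [ht] at this
        linarith [mul_le_mul_of_nonneg_left this hk.le]
    · intro y hy hyt
      have h : d < y := (lt_mul_of_one_lt_right hd hs1).trans_le hyt
      rw [hphigh y h]
      have : (y / d) ^ (-m2) ≤ s ^ (-m2) :=
        rpow_le_rpow_of_nonpos (by positivity) ((le_div_iff₀' hd).mpr hyt) (by linarith)
      rw [ht] at this
      linarith [mul_le_mul_of_nonneg_left this hk.le]
  · have hβh0 : 0 < βh := hβ0.trans_le hle
    have hAh : gh / βh + Z / R = Z * c2 := by
      have : gh / βh = -(Z * c1) := by rw [hβh']; field_simp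
      rw [this]
      linear_combination (-Z) * hc12
    have hA : gh / β + Z / R = (gh + Z * β / R) / β := by field_simp
    rw [hAh]
    set A := gh / β + Z / R with hAdef
    have hA0 : 0 < A := by rw [hA]; positivity
    have hgA : gh = β * A - β * Z * (c1 + c2) := by rw [hAdef, hc12]; field_simp; ring
    have ht : ((Z * c2 / A) ^ (1 / m1)) ^ (-m1) = A / (Z * c2) := by
      have := hm1neg.ne
      rw [← rpow_mul (by positivity), show 1 / m1 * -m1 = -1 by field_simp, rpow_neg_one, inv_div]
    have hs0 : 0 < (Z * c2 / A) ^ (1 / m1) := by positivity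
    set s := (Z * c2 / A) ^ (1 / m1) with hs
    have hAle : A ≤ Z * c2 := by
      rw [← hAh, hAdef]
      have : gh / β ≤ gh / βh := by
        rw [div_le_div_iff₀ hβ0 hβh0]
        exact mul_le_mul_of_nonpos_left hle hg.le
      linarith
    have hs1 : s ≤ 1 := by
      refine rpow_le_one_of_one_le_of_nonpos ((one_le_div hA0).mpr hAle) ?_
      exact div_nonpos_of_nonneg_of_nonpos zero_le_one hm1neg.le
    have hfoc : gh + β * Z * (c1 + c2 - c2 * (A / (Z * c2))) = 0 := by
      rw [hgA]; field_simp; ring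
    have hk : 0 < β * Z * c2 := by positivity
    refine clamp _ ?_ ?_
    · intro y hy hyt
      have h : y ≤ d := hyt.trans (mul_le_of_le_one_right hd.le hs1)
      rw [hplow y hy h]
      have : (y / d) ^ (-m1) ≤ s ^ (-m1) :=
        rpow_le_rpow (by positivity) ((div_le_iff₀' hd).mpr hyt) (by linarith)
      rw [ht] at this
      linarith [mul_le_mul_of_nonneg_left this hk.le]
    · intro y hy hyt
      rcases le_or_gt y d with h | h
      · rw [hplow y hy h]
        have : s ^ (-m1) ≤ (y / d) ^ (-m1) :=
          rpow_le_rpow hs0.le ((le_div_iff₀' hd).mpr hyt) (by linarith)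
        rw [ht] at this
        linarith [mul_le_mul_of_nonneg_left this hk.le]
      · have := mul_le_mul_of_nonneg_left (hpc1' y h) hβZ.le
        have : 0 ≤ (βh - β) * (Z * c1) := mul_nonneg (by linarith) (by positivity)
        linarith
end

section
/- Fix r > 0, λ ≥ 0, μ_d ∈ ℝ, σ_d > 0 with r_d := r − μ_d − σ_d²/2 > 0, define m₁, m₂, B₁, C₁ as in the incentive function, and fix Z > 0, d > 0, g_b ∈ ℝ, θ_b > 0, β ∈ (0,1) and y_h ≥ 0. Set β_b := 1 + g_b/(Z·B₁·(1−m₂)) and consider J̃_b(y_b) := g_b·y_b + (1−β)·Z·w(y_h + y_b, d) on [0, θ_b]. Then the following point y_b* is a maximizer of J̃_b over [0, θ_b]: y_b* = θ_b if g_b ≥ 0; y_b* = 0 if g_b + Z(1−β)/(r+λ) ≤ 0; y_b* = max( min( d·((1−β)/(1−β_b))^{1/m₂} − y_h, θ_b ), 0 ) if g_b < 0 < g_b + Z(1−β)/(r+λ) and β < β_b; and y_b* = max( min( d·((g_b/(1−β_b) + Z/(r+λ))/(g_b/(1−β) + Z/(r+λ)))^{1/m₁} − y_h, θ_b ), 0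 ) if g_b < 0 < g_b + Z(1−β)/(r+λ) and β ≥ β_b. -/
open Real Set

/-- A function on `[0, ∞)` that increases up to `Y` and decreases afterwards is maximized over the
shifted interval `a + [0, θ]` at the projection of `Y` onto it. -/
lemma isMaxOn_clamp {f : ℝ → ℝ} {Y a θ : ℝ} (ha : 0 ≤ a) (hθ : 0 ≤ θ)
    (hmono : MonotoneOn f (Icc 0 Y)) (hanti : AntitoneOn f (Ici Y)) :
    IsMaxOn (fun x => f (a + x)) (Icc 0 θ) (max (min (Y - a) θ) 0) := by
  rintro x ⟨hx0, hxθ⟩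
  simp only [mem_ofPred_eq]
  rcases le_total (Y - a) 0 with h0 | h0
  · rw [max_eq_right (min_le_of_left_le h0)]
    exact hanti (mem_Ici.2 (by linarith)) (mem_Ici.2 (by linarith)) (by linarith)
  rcases le_total (Y - a) θ with h1 | h1
  · rw [min_eq_left h1, max_eq_left h0, add_sub_cancel]
    rcases le_total (a + x) Y with h2 | h2
    · exact hmono ⟨by linarith, h2⟩ ⟨by linarith, le_rfl⟩ h2
    · exact hanti (mem_Ici.2 le_rfl) (mem_Ici.2 h2) h2
  · rw [min_eq_right h1, max_eq_left hθ]
    exact hmono ⟨by linarith, by linarith⟩ ⟨by linarith, by linarith⟩ (by linarith)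

/-- The sign of the derivative determines the maximizer over a shifted interval. -/
lemma isMaxOn_clamp_of_hasDerivAt {f f' : ℝ → ℝ} {Y a θ : ℝ} (ha : 0 ≤ a) (hθ : 0 ≤ θ)
    (hY : 0 ≤ Y) (hcont : ContinuousOn f (Ici 0)) (hderiv : ∀ y, 0 < y → HasDerivAt f (f' y) y)
    (hpos : ∀ y, 0 < y → y ≤ Y → 0 ≤ f' y) (hneg : ∀ y, 0 < y → Y ≤ y → f' y ≤ 0) :
    IsMaxOn (fun x => f (a + x)) (Icc 0 θ) (max (min (Y - a) θ) 0) := by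
  apply isMaxOn_clamp ha hθ
  · apply monotoneOn_of_hasDerivWithinAt_nonneg (f' := f') (convex_Icc 0 Y)
      (hcont.mono Icc_subset_Ici_self)
    · rw [interior_Icc]
      exact fun y hy => (hderiv y hy.1).hasDerivWithinAt
    · rw [interior_Icc]
      exact fun y hy => hpos y hy.1 hy.2.le
  · apply antitoneOn_of_hasDerivWithinAt_nonpos (f' := f') (convex_Ici Y)
      (hcont.mono (Ici_subset_Ici.2 hY))
    · rw [interior_Ici]
      exact fun y hy => (hderiv y (hY.trans_lt hy)).hasDerivWithinAt
    · rw [interior_Ici]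
      exact fun y hy => hneg y (hY.trans_lt hy) (le_of_lt hy)

/-- Differentiability of a function glued from two pieces with matching value and slope. -/
lemma hasDerivAt_glue {f g h : ℝ → ℝ} {d s : ℝ} (hf : HasDerivAt f s d) (hg : HasDerivAt g s d)
    (hl : ∀ᶠ y in nhds d, y ≤ d → h y = f y) (hr : ∀ᶠ y in nhds d, d ≤ y → h y = g y) :
    HasDerivAt h s d := by
  rw [← hasDerivWithinAt_univ, ← Iic_union_Ici (a := d)]
  refine HasDerivWithinAt.union ?_ ?_
  · exact hf.hasDerivWithinAt.congr_of_eventuallyEq (eventually_nhdsWithin_iff.2 hl)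
      (hl.self_of_nhds le_rfl)
  · exact hg.hasDerivWithinAt.congr_of_eventuallyEq (eventually_nhdsWithin_iff.2 hr)
      (hr.self_of_nhds le_rfl)

lemma hasDerivAt_mul_rpow_mul_add {b m d : ℝ} (hd : 0 < d) (c e : ℝ) {y : ℝ} (hy : 0 < y) :
    HasDerivAt (fun y : ℝ => b * y ^ (1 - m) * d ^ m + c * y + e)
      (b * (1 - m) * (y / d) ^ (-m) + c) y := by
  have h := (((((hasDerivAt_id y).rpow_const (p := 1 - m) (Or.inl hy.ne')).const_mul b).mul_const
    (d ^ m)).add ((hasDerivAt_id y).const_mul c)).add_const e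
  refine h.congr_deriv ?_
  rw [div_rpow hy.le hd.le, rpow_neg hd.le, show 1 - m - 1 = -m by ring]
  simp only [id, div_inv_eq_mul]
  ring

/-- The marginal incentive `∂w/∂y`, in terms of `a = B₁(1 - m₂)` and the limit `c = 1/(r + λ)`
at `y = 0`. -/
noncomputable def marginalIncentive (m1 m2 a c d y : ℝ) : ℝ :=
  if d < y then a * (y / d) ^ (-m2) else c - (c - a) * (y / d) ^ (-m1)

section marginalIncentive

variable {m1 m2 a c d : ℝ}

lemma marginalIncentive_antitoneOn (hm1 : m1 < 0) (hm2 : 0 < m2) (ha : 0 < a) (hac : a < c)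
    (hd : 0 < d) : AntitoneOn (marginalIncentive m1 m2 a c d) (Ioi 0) := by
  intro x hx y hy hxy
  rw [mem_Ioi] at hx hy
  unfold marginalIncentive
  have hdiv : x / d ≤ y / d := by gcongr
  have hx' : 0 < x / d := by positivity
  have hca : 0 ≤ c - a := by linarith
  split_ifs with h1 h2 h2
  · exact mul_le_mul_of_nonneg_left (rpow_le_rpow_of_nonpos hx' hdiv (by linarith)) ha.le
  · have e1 : (y / d) ^ (-m2) ≤ 1 :=
      rpow_le_one_of_one_le_of_nonpos ((one_le_div hd).2 h1.le) (by linarith)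
    have e2 : (x / d) ^ (-m1) ≤ 1 :=
      rpow_le_one hx'.le ((div_le_one hd).2 (not_lt.1 h2)) (by linarith)
    nlinarith
  · exact absurd (h2.trans_le hxy) h1
  · have := mul_le_mul_of_nonneg_left (rpow_le_rpow hx'.le hdiv (z := -m1) (by linarith)) hca
    linarith

lemma marginalIncentive_nonneg (hm1 : m1 < 0) (ha : 0 < a) (hac : a < c)
    (hd : 0 < d) {y : ℝ} (hy : 0 < y) : 0 ≤ marginalIncentive m1 m2 a c d y := by
  unfold marginalIncentive
  split_ifs with h
  · positivity
  · have e2 : (y / d) ^ (-m1) ≤ 1 :=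
      rpow_le_one (by positivity) ((div_le_one hd).2 (not_lt.1 h)) (by linarith)
    nlinarith

lemma marginalIncentive_le (hm2 : 0 < m2) (ha : 0 < a) (hac : a < c)
    (hd : 0 < d) {y : ℝ} (hy : 0 < y) : marginalIncentive m1 m2 a c d y ≤ c := by
  unfold marginalIncentive
  split_ifs with h
  · have e1 : (y / d) ^ (-m2) ≤ 1 :=
      rpow_le_one_of_one_le_of_nonpos ((one_le_div hd).2 h.le) (by linarith)
    nlinarith
  · have := mul_nonneg (sub_nonneg.2 hac.le) (rpow_nonneg (by positivity : 0 ≤ y / d) (-m1))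
    linarith

lemma marginalIncentive_mul_rpow_of_one_lt (hm2 : 0 < m2) (hd : 0 < d) {t : ℝ} (ht : 1 < t) :
    marginalIncentive m1 m2 a c d (d * t ^ (1 / m2)) = a / t := by
  have h1 : d < d * t ^ (1 / m2) :=
    lt_mul_of_one_lt_right hd (one_lt_rpow ht (by positivity))
  rw [marginalIncentive, if_pos h1, mul_div_cancel_left₀ _ hd.ne', ← rpow_mul (by positivity),
    show 1 / m2 * -m2 = -1 by field_simp, rpow_neg_one, div_eq_mul_inv]

lemma marginalIncentive_mul_rpow_of_one_le (hm1 : m1 < 0) (hd : 0 < d) {t : ℝ} (ht : 1 ≤ t) :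
    marginalIncentive m1 m2 a c d (d * t ^ (1 / m1)) = c - (c - a) / t := by
  have h1 : ¬ d < d * t ^ (1 / m1) := not_lt.2 (mul_le_of_le_one_right hd.le
    (rpow_le_one_of_one_le_of_nonpos ht (one_div_neg.2 hm1).le))
  rw [marginalIncentive, if_neg h1, mul_div_cancel_left₀ _ hd.ne', ← rpow_mul (by positivity),
    show 1 / m1 * -m1 = -1 by field_simp [hm1.ne], rpow_neg_one, div_eq_mul_inv]

end marginalIncentive

/-- Regularity of the incentive function: it is continuous on `[0, ∞)` and continuously
differentiable on `(0, ∞)`, the two pieces being pasted smoothly at `y = d`. -/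
lemma incentive_regularity {m1 m2 a c d B C e : ℝ} {W : ℝ → ℝ} (hm1 : m1 < 0)
    (hd : 0 < d)
    (hW : ∀ y, W y = if y = 0 then 0 else if d < y then B * y ^ (1 - m2) * d ^ m2 + e
      else C * y ^ (1 - m1) * d ^ m1 + c * y)
    (hB : B * (1 - m2) = a) (hC : C * (1 - m1) = a - c) (he : B * d + e = C * d + c * d) :
    ContinuousOn W (Ici 0) ∧
      ∀ y, 0 < y → HasDerivAt W (marginalIncentive m1 m2 a c d y) y := by
  set F : ℝ → ℝ := fun y => C * y ^ (1 - m1) * d ^ m1 + c * y + 0 with hF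
  set G : ℝ → ℝ := fun y => B * y ^ (1 - m2) * d ^ m2 + 0 * y + e with hG
  have hpow : ∀ m : ℝ, d ^ (1 - m) * d ^ m = d := fun m => by
    rw [← rpow_add hd, sub_add_cancel, rpow_one]
  have hWF : ∀ y, y ≤ d → W y = F y := fun y hy => by
    rw [hW, if_neg hy.not_gt]
    split_ifs with h
    · simp [hF, h, zero_rpow (by linarith : 1 - m1 ≠ 0)]
    · simp [hF]
  have hWG : ∀ y, d ≤ y → W y = G y := fun y hy => by
    rcases hy.eq_or_lt with rfl | hy
    · rw [hWF d le_rfl]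
      simp only [hF, hG, mul_assoc, hpow]
      linarith
    · rw [hW, if_neg (hd.trans hy).ne', if_pos hy]
      simp [hG]
  have hFd : ∀ y, 0 < y → HasDerivAt F (c - (c - a) * (y / d) ^ (-m1)) y := fun y hy => by
    refine (hasDerivAt_mul_rpow_mul_add hd c 0 hy).congr_deriv ?_
    rw [hC]; ring
  have hGd : ∀ y, 0 < y → HasDerivAt G (a * (y / d) ^ (-m2)) y := fun y hy => by
    refine (hasDerivAt_mul_rpow_mul_add hd 0 e hy).congr_deriv ?_
    rw [hB]; ring
  have hderiv : ∀ y, 0 < y → HasDerivAt W (marginalIncentive m1 m2 a c d y) y := by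
    intro y hy
    unfold marginalIncentive
    rcases lt_trichotomy y d with h | rfl | h
    · rw [if_neg h.not_gt]
      exact (hFd y hy).congr_of_eventuallyEq
        ((eventually_lt_nhds h).mono fun z hz => hWF z hz.le)
    · rw [if_neg (lt_irrefl _)]
      refine hasDerivAt_glue (hFd y hy) ((hGd y hy).congr_deriv ?_)
        (Filter.Eventually.of_forall hWF) (Filter.Eventually.of_forall hWG)
      rw [div_self hd.ne', one_rpow, one_rpow]; ring
    · rw [if_pos h]
      exact (hGd y hy).congr_of_eventuallyEq
        ((eventually_gt_nhds h).mono fun z hz => hWG z (le_of_lt hz))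
  refine ⟨fun y hy => ?_, hderiv⟩
  rcases (mem_Ici.1 hy).eq_or_lt with rfl | hy
  · have hFc : ContinuousAt F 0 := by
      have := continuousAt_rpow_const 0 (1 - m1) (Or.inr (by linarith))
      simp only [hF]
      fun_prop
    exact (hFc.congr ((eventually_lt_nhds hd).mono fun z hz =>
      (hWF z hz.le).symm)).continuousWithinAt
  · exact (hderiv y hy).continuousAt.continuousWithinAt

/-- The roots `m₁`, `m₂` of the characteristic equation `σ²m²/2 + μm = R`, and their location. -/
lemma characteristic_roots_s12 {R mu s m1 m2 : ℝ} (hR : 0 < R) (hs : 0 < s)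
    (hD : 0 < R - mu - s / 2)
    (hm1 : m1 = (-mu - √(mu ^ 2 + 2 * R * s)) / s)
    (hm2 : m2 = (-mu + √(mu ^ 2 + 2 * R * s)) / s) :
    m1 < 0 ∧ 1 < m2 ∧ s * (m1 + m2) = -2 * mu ∧ s * (m1 * m2) = -2 * R := by
  set q := √(mu ^ 2 + 2 * R * s) with hq
  have hq2 : q ^ 2 = mu ^ 2 + 2 * R * s := sq_sqrt (by positivity)
  have hRs : 0 < R * s := mul_pos hR hs
  have hq1 : |mu| < q := abs_lt_of_sq_lt_sq' (by linarith) (sqrt_nonneg _) |> abs_lt.2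
  have hq3 : s + mu < q := by
    refine lt_sqrt_of_sq_lt ?_
    nlinarith
  have hlt := neg_abs_le mu
  refine ⟨?_, ?_, ?_, ?_⟩
  · rw [hm1]
    exact div_neg_of_neg_of_pos (by linarith) hs
  · rw [hm2, lt_div_iff₀ hs]
    linarith
  · rw [hm1, hm2]
    field_simp
    ring
  · rw [hm1, hm2]
    field_simp
    linarith

/-- Biogas producer's best response: for fixed incentive share β and household
installation y_h, the stated point y_b* maximizes the biogas producer's reduced
payoff J̃_b(y_b) = g_b·y_b + (1−β)·Z·w(y_h + y_b, d) over [0, θ_b], in each case. -/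
theorem stmt_12 (r lam mud sigd : ℝ) (hr : 0 < r) (hlam : 0 ≤ lam) (hsigd : 0 < sigd)
    (hrd : 0 < r - mud - sigd ^ 2 / 2)
    (m1 m2 B1 C1 : ℝ)
    (hm1 : m1 = (-mud - Real.sqrt (mud ^ 2 + 2 * (r + lam) * sigd ^ 2)) / sigd ^ 2)
    (hm2 : m2 = (-mud + Real.sqrt (mud ^ 2 + 2 * (r + lam) * sigd ^ 2)) / sigd ^ 2)
    (hB1 : B1 = (m1 * mud + m1 * sigd ^ 2 / 2 - r - lam) /
        ((r + lam) * ((r - mud - sigd ^ 2 / 2) + lam) * (m2 - m1)))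
    (hC1 : C1 = (m2 * mud + m2 * sigd ^ 2 / 2 - r - lam) /
        ((r + lam) * ((r - mud - sigd ^ 2 / 2) + lam) * (m2 - m1)))
    (w : ℝ → ℝ → ℝ)
    (hw : ∀ y d : ℝ, w y d =
      if y = 0 then 0
      else if d < y then B1 * y ^ (1 - m2) * d ^ m2 + d / ((r - mud - sigd ^ 2 / 2) + lam)
      else C1 * y ^ (1 - m1) * d ^ m1 + y / (r + lam))
    (Z d gb θb β yh : ℝ) (hZ : 0 < Z) (hd : 0 < d) (hθb : 0 < θb)
    (hβ : β ∈ Set.Ioo (0 : ℝ) 1) (hyh : 0 ≤ yh)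
    (βb : ℝ) (hβb : βb = 1 + gb / (Z * B1 * (1 - m2))) :
    (0 ≤ gb →
      IsMaxOn (fun yb => gb * yb + (1 - β) * Z * w (yh + yb) d) (Icc 0 θb) θb) ∧
    (gb + Z * (1 - β) / (r + lam) ≤ 0 →
      IsMaxOn (fun yb => gb * yb + (1 - β) * Z * w (yh + yb) d) (Icc 0 θb) 0) ∧
    (gb < 0 → 0 < gb + Z * (1 - β) / (r + lam) → β < βb →
      IsMaxOn (fun yb => gb * yb + (1 - β) * Z * w (yh + yb) d) (Icc 0 θb)
        (max (min (d * ((1 - β) / (1 - βb)) ^ (1 / m2) - yh) θb) 0)) ∧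
    (gb < 0 → 0 < gb + Z * (1 - β) / (r + lam) → βb ≤ β →
      IsMaxOn (fun yb => gb * yb + (1 - β) * Z * w (yh + yb) d) (Icc 0 θb)
        (max (min (d * ((gb / (1 - βb) + Z / (r + lam)) /
          (gb / (1 - β) + Z / (r + lam))) ^ (1 / m1) - yh) θb) 0)) := by
  have hR : 0 < r + lam := by linarith
  have hs : 0 < sigd ^ 2 := by positivity
  obtain ⟨hm1n, hm2o, hsum, hprod⟩ :=
    characteristic_roots_s12 hR hs (by linarith) hm1 hm2
  clear hm1 hm2
  obtain ⟨R, hRdef⟩ : ∃ R, R = r + lam := ⟨_, rfl⟩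
  obtain ⟨D, hDdef⟩ : ∃ D, D = r - mud - sigd ^ 2 / 2 + lam := ⟨_, rfl⟩
  obtain ⟨s, hsdef⟩ : ∃ s, s = sigd ^ 2 := ⟨_, rfl⟩
  have hD : 0 < D := by linarith
  rw [← hDdef, ← hRdef, ← hsdef] at hB1 hC1
  simp only [← hDdef, ← hRdef] at hw hR hprod ⊢
  rw [← hsdef] at hsum hprod hs
  have hDR : D = R - mud - s / 2 := by rw [hDdef, hRdef, hsdef]; ring
  have hm : 0 < m2 - m1 := by linarith
  have hmud : mud = -(s * (m1 + m2)) / 2 := by linarith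
  have hRm : R = -(s * (m1 * m2)) / 2 := by linarith
  have hDm : D = -(s * ((1 - m1) * (1 - m2))) / 2 := by rw [hDR, hRm, hmud]; ring
  obtain ⟨a, ha⟩ : ∃ a, a = B1 * (1 - m2) := ⟨_, rfl⟩
  have hN1 : m1 * mud + m1 * s / 2 - r - lam = s / 2 * m1 * (1 - m1) := by
    have : m1 * mud + m1 * s / 2 - R = s / 2 * m1 * (1 - m1) := by rw [hmud, hRm]; ring
    linarith
  have hN2 : m2 * mud + m2 * s / 2 - r - lam = s / 2 * m2 * (1 - m2) := by
    have : m2 * mud + m2 * s / 2 - R = s / 2 * m2 * (1 - m2) := by rw [hmud, hRm]; ring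
    linarith
  have haval : a = -m1 / (R * (m2 - m1)) := by
    rw [ha, hB1, hN1, div_mul_eq_mul_div, div_eq_div_iff (by positivity) (by positivity), hDm]
    ring
  have hCa : C1 * (1 - m1) = a - R⁻¹ := by
    have h : C1 * (1 - m1) = -m2 / (R * (m2 - m1)) := by
      rw [hC1, hN2, div_mul_eq_mul_div, div_eq_div_iff (by positivity) (by positivity), hDm]
      ring
    rw [h, haval]
    field_simp
    ring
  have hapos : 0 < a := by rw [haval]; exact div_pos (by linarith) (by positivity)
  have hac : a < R⁻¹ := by
    rw [haval, div_lt_iff₀ (by positivity), inv_mul_cancel_left₀ hR.ne']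
    linarith
  have hpaste : B1 * d + d / D = C1 * d + R⁻¹ * d := by
    have h : C1 - B1 = D⁻¹ - R⁻¹ := by
      rw [hC1, hB1, ← sub_div, inv_sub_inv hD.ne' hR.ne', div_eq_div_iff (by positivity)
        (by positivity), hDR]
      ring
    rw [div_eq_mul_inv]
    linear_combination -d * h
  obtain ⟨hcont, hder⟩ := incentive_regularity (W := fun y => w y d) (e := d / D) hm1n hd
    (fun y => by simp only [hw]; rw [div_eq_inv_mul y R]) ha.symm hCa hpaste
  obtain ⟨hβ0, hβ1⟩ := hβ
  obtain ⟨k, hk⟩ : ∃ k, k = (1 - β) * Z := ⟨_, rfl⟩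
  have hkpos : 0 < k := by rw [hk]; exact mul_pos (by linarith) hZ
  obtain ⟨p, hp⟩ : ∃ p, p = marginalIncentive m1 m2 a R⁻¹ d := ⟨_, rfl⟩
  rw [← hp] at hder
  have hpanti : AntitoneOn p (Ioi 0) :=
    hp ▸ marginalIncentive_antitoneOn hm1n (by linarith) hapos hac hd
  obtain ⟨f, hf⟩ : ∃ f : ℝ → ℝ, f = fun y => gb * y + k * w y d := ⟨_, rfl⟩
  have hfcont : ContinuousOn f (Ici 0) := by
    rw [hf]
    exact (continuousOn_const.mul continuousOn_id).add (continuousOn_const.mul hcont)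
  have hfder : ∀ y, 0 < y → HasDerivAt f (gb + k * p y) y := fun y hy => by
    rw [hf]
    exact (((hasDerivAt_id y).const_mul gb).add ((hder y hy).const_mul k)).congr_deriv (by simp)
  have key : ∀ x, IsMaxOn (fun yb => f (yh + yb)) (Icc 0 θb) x →
      IsMaxOn (fun yb => gb * yb + (1 - β) * Z * w (yh + yb) d) (Icc 0 θb) x := by
    intro x hx y hy
    have := hx hy
    simp only [hf, mem_ofPred_eq, ← hk] at this ⊢
    linarith
  have critical : ∀ Y, 0 < Y → gb + k * p Y = 0 →
      IsMaxOn (fun yb => gb * yb + (1 - β) * Z * w (yh + yb) d) (Icc 0 θb)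
        (max (min (Y - yh) θb) 0) := by
    intro Y hY h0
    refine key _ (isMaxOn_clamp_of_hasDerivAt hyh hθb.le hY.le hfcont hfder ?_ ?_)
    · intro y hy hyY
      have := mul_le_mul_of_nonneg_left (hpanti hy hY hyY) hkpos.le
      linarith
    · intro y hy hyY
      have := mul_le_mul_of_nonneg_left (hpanti hY hy hyY) hkpos.le
      linarith
  have hbb : 1 - βb = -gb / (Z * a) := by
    rw [hβb, ha, mul_assoc]; ring
  have h1β : 0 < 1 - β := by linarith
  refine ⟨fun hg => ?_, fun hg => ?_, fun hg hg' hb => ?_, fun hg hg' hb => ?_⟩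
  · refine key _ fun y hy => ?_
    have hmono : MonotoneOn f (Ici 0) := by
      refine monotoneOn_of_hasDerivWithinAt_nonneg (f' := fun y => gb + k * p y) (convex_Ici 0)
        hfcont ?_ ?_ <;> rw [interior_Ici] <;> intro y hy
      · exact (hfder y hy).hasDerivWithinAt
      · have := hp ▸ marginalIncentive_nonneg (m2 := m2) hm1n hapos hac hd hy
        positivity
    exact hmono (mem_Ici.2 (by linarith [hy.1])) (mem_Ici.2 (by linarith))
      (by linarith [hy.2])
  · have hneg : ∀ y, 0 < y → 0 ≤ y → gb + k * p y ≤ 0 := by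
      intro y hy _
      have h1 : p y ≤ R⁻¹ := hp ▸ marginalIncentive_le (by linarith) hapos hac hd hy
      have h2 := mul_le_mul_of_nonneg_left h1 hkpos.le
      have h3 : Z * (1 - β) / R = k * R⁻¹ := by rw [hk]; ring
      linarith
    have h := isMaxOn_clamp_of_hasDerivAt hyh hθb.le le_rfl hfcont hfder
      (fun y hy hy' => absurd hy hy'.not_gt) hneg
    rw [max_eq_right (min_le_of_left_le (by linarith))] at h
    exact key _ h
  · have hbpos : 0 < 1 - βb := by rw [hbb]; exact div_pos (by linarith) (by positivity)
    have ht : 1 < (1 - β) / (1 - βb) := by rw [one_lt_div hbpos]; linarith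
    refine critical _ (by positivity) ?_
    rw [hp, marginalIncentive_mul_rpow_of_one_lt (by linarith) hd ht, hbb, hk]
    have hgb : -gb ≠ 0 := by linarith
    field_simp
    ring
  · have hgne : gb ≠ 0 := hg.ne
    have hnum : gb / (1 - βb) + Z / R = Z * (R⁻¹ - a) := by
      rw [hbb]
      field_simp
      ring
    have hden : gb / (1 - β) + Z / R = (gb + Z * (1 - β) / R) / (1 - β) := by
      field_simp
    have hdpos : 0 < gb / (1 - β) + Z / R := by rw [hden]; positivity
    have hga : gb / (1 - β) ≤ -(Z * a) := by
      have h1 : 1 - β ≤ -gb / (Z * a) := by linarith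
      rw [le_div_iff₀ (by positivity)] at h1
      rw [div_le_iff₀ h1β]
      linarith
    have ht : 1 ≤ (gb / (1 - βb) + Z / R) / (gb / (1 - β) + Z / R) := by
      rw [one_le_div hdpos, hnum, mul_sub, ← div_eq_mul_inv]
      linarith
    refine critical _ (by positivity) ?_
    have hRa : R⁻¹ - a ≠ 0 := by linarith
    have hval : (R⁻¹ - a) / (Z * (R⁻¹ - a) / (gb / (1 - β) + Z / R)) =
        (gb / (1 - β) + Z / R) / Z := by
      rw [div_div_eq_mul_div, mul_comm Z, mul_div_mul_left _ _ hRa]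
    rw [hp, marginalIncentive_mul_rpow_of_one_le hm1n hd ht, hnum, hval, hk]
    field_simp
    ring
end

section
/- Fix r > 0, λ ≥ 0, μ_d ∈ ℝ, σ_d > 0 with r_d := r − μ_d − σ_d²/2 > 0, define m₁, m₂, B₁, C₁ as in the incentive function, and fix Z > 0, d > 0, θ_h, θ_b > 0, β ∈ (0,1) and net unit gains g_h ≥ 0, g_b ≥ 0. Then the strategy pair (y_h*, y_b*) = (θ_h, θ_b) is a Nash equilibrium: g_h·y_h + β·Z·w(y_h + θ_b, d) ≤ g_h·θ_h + β·Z·w(θ_h + θ_b, d) for all y_h ∈ [0, θ_h], and g_b·y_b + (1−β)·Z·w(θ_h + y_b, d) ≤ g_b·θ_b + (1−β)·Z·w(θ_h + θ_b, d) for all y_b ∈ [0, θ_b]. -/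
open Real Set

lemma rpow_sub_rpow_le_mul {p u t : ℝ} (hp : 1 ≤ p) (hu : 0 < u) (hut : u ≤ t) (ht : t ≤ 1) :
    t ^ p - u ^ p ≤ p * (t - u) := by
  have ht0 : 0 < t := hu.trans_le hut
  have bernoulli : 1 + p * (u / t - 1) ≤ (u / t) ^ p := by
    have h := one_add_mul_self_le_rpow_one_add (s := u / t - 1)
      (by linarith [(div_pos hu ht0).le]) hp
    rwa [add_sub_cancel] at h
  rw [Real.div_rpow hu.le ht0.le, le_div_iff₀ (Real.rpow_pos_of_pos ht0 p)] at bernoulli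
  have hpow : t ^ p ≤ t := by
    simpa using Real.rpow_le_rpow_of_exponent_ge ht0 ht hp
  have hfac : 0 ≤ p * (1 - u / t) :=
    mul_nonneg (by linarith) (sub_nonneg.2 ((div_le_one ht0).2 hut))
  calc t ^ p - u ^ p ≤ p * (1 - u / t) * t ^ p := by linarith
    _ ≤ p * (1 - u / t) * t := mul_le_mul_of_nonneg_left hpow hfac
    _ = p * (t - u) := by field_simp

lemma rpow_one_sub_mul_rpow {y d : ℝ} (hy : 0 < y) (hd : 0 < d) (m : ℝ) :
    y ^ (1 - m) * d ^ m = d * (y / d) ^ (1 - m) := by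
  have h : d ^ (1 - m) * d ^ m = d := by
    rw [← Real.rpow_add hd, sub_add_cancel, Real.rpow_one]
  rw [Real.div_rpow hy.le hd.le]
  rw [← mul_div_assoc, eq_div_iff (Real.rpow_pos_of_pos hd (1 - m)).ne']
  linear_combination y ^ (1 - m) * h

/-- A function of the form of the incentive function, with continuous pasting at `y = d`,
is nondecreasing in `y > 0`. -/
lemma monotoneOn_pasted_rpow {m1 m2 B C D R d : ℝ} (hd : 0 < d) (hB : B ≤ 0) (hC : C ≤ 0)
    (hm1 : m1 ≤ 0) (hm2 : 1 ≤ m2) (hCR : -C * (1 - m1) ≤ 1 / R)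
    (hpaste : B + 1 / D = C + 1 / R) :
    MonotoneOn (fun y : ℝ => if d < y then B * y ^ (1 - m2) * d ^ m2 + d / D
      else C * y ^ (1 - m1) * d ^ m1 + y / R) (Ioi 0) := by
  have upper : ∀ x y : ℝ, 0 < x → x ≤ y →
      B * x ^ (1 - m2) * d ^ m2 ≤ B * y ^ (1 - m2) * d ^ m2 := by
    intro x y hx hxy
    have h := mul_le_mul_of_nonpos_left
      (Real.rpow_le_rpow_of_nonpos hx hxy (by linarith : 1 - m2 ≤ 0)) hB
    exact mul_le_mul_of_nonneg_right h (Real.rpow_pos_of_pos hd m2).le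
  have lower : ∀ x y : ℝ, 0 < x → x ≤ y → y ≤ d →
      C * x ^ (1 - m1) * d ^ m1 + x / R ≤ C * y ^ (1 - m1) * d ^ m1 + y / R := by
    intro x y hx hxy hyd
    rw [mul_assoc, mul_assoc, rpow_one_sub_mul_rpow hx hd,
      rpow_one_sub_mul_rpow (hx.trans_le hxy) hd]
    have hxyd : x / d ≤ y / d := div_le_div_of_nonneg_right hxy hd.le
    have h1 := rpow_sub_rpow_le_mul (by linarith : 1 ≤ 1 - m1) (div_pos hx hd) hxyd
      ((div_le_one hd).2 hyd)
    have h2 := mul_le_mul_of_nonneg_left h1 (mul_nonneg hd.le (neg_nonneg.2 hC))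
    have h3 := mul_le_mul_of_nonneg_right hCR (sub_nonneg.2 hxy)
    have h4 : d * -C * ((1 - m1) * (y / d - x / d)) = -C * (1 - m1) * (y - x) := by
      field_simp
    have h5 : 1 / R * (y - x) = y / R - x / R := by ring
    linarith
  have diag : ∀ m : ℝ, d ^ (1 - m) * d ^ m = d := fun m => by
    rw [← Real.rpow_add hd, sub_add_cancel, Real.rpow_one]
  have hglue : C * d ^ (1 - m1) * d ^ m1 + d / R = B * d ^ (1 - m2) * d ^ m2 + d / D := by
    rw [mul_assoc, mul_assoc, diag, diag]
    linear_combination -d * hpaste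
  intro x hx y _ hxy
  dsimp only
  split_ifs with hdx hdy hdy
  · linarith [upper x y hx hxy]
  · linarith
  · linarith [lower x d hx (not_lt.1 hdx) le_rfl, upper d y hd hdy.le]
  · exact lower x y hx hxy (not_lt.1 hdy)

/-- If both net unit gains are nonnegative, the strategy pair (θ_h, θ_b) is a Nash
equilibrium of the installation game. -/
theorem stmt_14 (r lam mud sigd : ℝ) (hr : 0 < r) (hlam : 0 ≤ lam) (hsigd : 0 < sigd)
    (hrd : 0 < r - mud - sigd ^ 2 / 2)
    (m1 m2 B1 C1 : ℝ)
    (hm1 : m1 = (-mud - Real.sqrt (mud ^ 2 + 2 * (r + lam) * sigd ^ 2)) / sigd ^ 2)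
    (hm2 : m2 = (-mud + Real.sqrt (mud ^ 2 + 2 * (r + lam) * sigd ^ 2)) / sigd ^ 2)
    (hB1 : B1 = (m1 * mud + m1 * sigd ^ 2 / 2 - r - lam) /
        ((r + lam) * ((r - mud - sigd ^ 2 / 2) + lam) * (m2 - m1)))
    (hC1 : C1 = (m2 * mud + m2 * sigd ^ 2 / 2 - r - lam) /
        ((r + lam) * ((r - mud - sigd ^ 2 / 2) + lam) * (m2 - m1)))
    (w : ℝ → ℝ → ℝ)
    (hw : ∀ y d : ℝ, w y d =
      if y = 0 then 0
      else if d < y then B1 * y ^ (1 - m2) * d ^ m2 + d / ((r - mud - sigd ^ 2 / 2) + lam)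
      else C1 * y ^ (1 - m1) * d ^ m1 + y / (r + lam))
    (Z d θh θb β gh gb : ℝ) (hZ : 0 < Z) (hd : 0 < d) (hθh : 0 < θh) (hθb : 0 < θb)
    (hβ : β ∈ Set.Ioo (0 : ℝ) 1) (hgh : 0 ≤ gh) (hgb : 0 ≤ gb) :
    (∀ yh ∈ Icc (0 : ℝ) θh,
      gh * yh + β * Z * w (yh + θb) d ≤ gh * θh + β * Z * w (θh + θb) d) ∧
    (∀ yb ∈ Icc (0 : ℝ) θb,
      gb * yb + (1 - β) * Z * w (θh + yb) d ≤ gb * θb + (1 - β) * Z * w (θh + θb) d) := by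
  set R := r + lam with hR
  set D := r - mud - sigd ^ 2 / 2 + lam with hD
  have hR0 : 0 < R := by linarith
  have hD0 : 0 < D := by linarith
  have hs : 0 < sigd ^ 2 := by positivity
  have hdisc : mud ^ 2 < mud ^ 2 + 2 * R * sigd ^ 2 := by
    linarith [mul_pos (mul_pos two_pos hR0) hs]
  obtain ⟨q, hq⟩ : ∃ q, q = √(mud ^ 2 + 2 * R * sigd ^ 2) := ⟨_, rfl⟩
  have hqq : q ^ 2 = mud ^ 2 + 2 * R * sigd ^ 2 := by
    rw [hq, Real.sq_sqrt (by linarith [sq_nonneg mud])]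
  have hq_abs : |mud| < q := by
    rw [hq, ← Real.sqrt_sq_eq_abs]
    exact Real.sqrt_lt_sqrt (sq_nonneg _) hdisc
  obtain ⟨hq1, hq2⟩ := abs_lt.1 hq_abs
  rw [← hq] at hm1 hm2
  have hm1_neg : m1 < 0 := by
    rw [hm1]
    exact div_neg_of_neg_of_pos (by linarith) hs
  have hm2_pos : 0 < m2 := by
    rw [hm2]
    exact div_pos (by linarith) hs
  have hsum : sigd ^ 2 * (m1 + m2) = -2 * mud := by
    rw [hm1, hm2]
    field_simp
    ring
  have hprod : sigd ^ 2 * (m1 * m2) = -2 * R := by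
    rw [hm1, hm2]
    field_simp
    linear_combination -hqq
  have hDfac : D = sigd ^ 2 / 2 * ((m2 - 1) * (1 - m1)) := by
    have : D = R - mud - sigd ^ 2 / 2 := by rw [hD, hR]; ring
    linear_combination this - hsum / 2 + hprod / 2
  have hm2_one : 0 < m2 - 1 := by
    have h : 0 < (sigd ^ 2 / 2 * (1 - m1)) * (m2 - 1) := by
      rw [show sigd ^ 2 / 2 * (1 - m1) * (m2 - 1) = D by rw [hDfac]; ring]
      exact hD0
    exact pos_of_mul_pos_right h (mul_nonneg (by positivity) (by linarith))
  have h1m1 : 0 < 1 - m1 := by linarith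
  have hdiff : 0 < m2 - m1 := by linarith
  have hB : B1 = m1 / (R * (m2 - 1) * (m2 - m1)) := by
    have hnum : m1 * mud + m1 * sigd ^ 2 / 2 - r - lam = sigd ^ 2 / 2 * (m1 * (1 - m1)) := by
      linear_combination hR + m1 / 2 * hsum - hprod / 2
    rw [hB1, hnum, hDfac]
    field_simp
  have hC : C1 = -m2 / (R * (1 - m1) * (m2 - m1)) := by
    have hnum : m2 * mud + m2 * sigd ^ 2 / 2 - r - lam = sigd ^ 2 / 2 * (m2 * (1 - m2)) := by
      linear_combination hR + m2 / 2 * hsum - hprod / 2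
    rw [hC1, hnum, hDfac]
    field_simp
    ring
  have hB_nonpos : B1 ≤ 0 := by
    rw [hB]
    exact div_nonpos_of_nonpos_of_nonneg hm1_neg.le (by positivity)
  have hC_nonpos : C1 ≤ 0 := by
    rw [hC]
    exact div_nonpos_of_nonpos_of_nonneg (by linarith) (by positivity)
  have hCR : -C1 * (1 - m1) ≤ 1 / R := by
    have h : -C1 * (1 - m1) = m2 / (m2 - m1) * (1 / R) := by
      rw [hC]
      field_simp
    rw [h]
    exact mul_le_of_le_one_left (by positivity) ((div_le_one hdiff).2 (by linarith))
  have hpaste : B1 + 1 / D = C1 + 1 / R := by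
    have hRfac : R = -(sigd ^ 2 / 2 * (m1 * m2)) := by linear_combination hprod / 2
    have hinv : 1 / D = -(m1 * m2) / (R * ((m2 - 1) * (1 - m1))) := by
      rw [div_eq_div_iff hD0.ne' (by positivity), hDfac]
      linear_combination (m2 - 1) * (1 - m1) * hRfac
    rw [hinv, hB, hC]
    field_simp
    ring
  have hmono : ∀ x y : ℝ, 0 < x → x ≤ y → w x d ≤ w y d := by
    intro x y hx hxy
    rw [hw, hw, if_neg hx.ne', if_neg (hx.trans_le hxy).ne']
    exact monotoneOn_pasted_rpow hd hB_nonpos hC_nonpos hm1_neg.le (by linarith) hCR hpaste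
      hx (hx.trans_le hxy) hxy
  refine ⟨fun yh hyh => ?_, fun yb hyb => ?_⟩
  · exact add_le_add (mul_le_mul_of_nonneg_left hyh.2 hgh)
      (mul_le_mul_of_nonneg_left (hmono _ _ (by linarith [hyh.1]) (by linarith [hyh.2]))
        (mul_nonneg hβ.1.le hZ.le))
  · exact add_le_add (mul_le_mul_of_nonneg_left hyb.2 hgb)
      (mul_le_mul_of_nonneg_left (hmono _ _ (by linarith [hyb.1]) (by linarith [hyb.2]))
        (mul_nonneg (sub_nonneg.2 hβ.2.le) hZ.le))
end

section
/- Fix r > 0, λ ≥ 0, μ_d ∈ ℝ, σ_d > 0 with r_d := r − μ_d − σ_d²/2 > 0, define m₁, m₂, B₁, C₁ as in the incentive function, and fix Z > 0, d > 0, θ_h, θ_b > 0, β ∈ (0,1), g_b ≥ 0, and g_h with g_h + Z·β/(r+λ) ≤ 0. Then the strategy pair (y_h*, y_b*) = (0, θ_b) is a Nash equilibrium: g_h·y_h + β·Z·w(y_h + θ_b, d) ≤ β·Z·w(θ_b, d) for all y_h ∈ [0, θ_h], and g_b·y_b + (1−β)·Z·w(y_b, d) ≤ g_b·θ_b + (1−β)·Z·w(θ_b,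 d) for all y_b ∈ [0, θ_b]. -/
open Real Set

/-- Increments of a function whose derivative lies between `0` and `L`. -/
theorem sub_mem_Icc_of_hasDerivAt {f f' : ℝ → ℝ} {a b L : ℝ} (hab : a ≤ b)
    (hc : ContinuousOn f (Icc a b)) (hd : ∀ x ∈ Ioo a b, HasDerivAt f (f' x) x)
    (hf' : ∀ x ∈ Ioo a b, f' x ∈ Icc 0 L) :
    f b - f a ∈ Icc 0 (L * (b - a)) := by
  rcases hab.eq_or_lt with rfl | hlt
  · simp
  obtain ⟨c, hcm, hcs⟩ := exists_hasDerivAt_eq_slope f f' hlt hc hd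
  have hpos : 0 < b - a := sub_pos.2 hlt
  have heq : f b - f a = f' c * (b - a) := by rw [hcs]; field_simp
  rw [heq]
  exact ⟨mul_nonneg (hf' c hcm).1 hpos.le, mul_le_mul_of_nonneg_right (hf' c hcm).2 hpos.le⟩

theorem hasDerivAt_mul_rpow_mul_add_div (C m K R : ℝ) {x : ℝ} (hx : 0 < x) :
    HasDerivAt (fun y : ℝ => C * y ^ (1 - m) * K + y / R)
      (C * (1 - m) * (x ^ (-m) * K) + 1 / R) x := by
  have h := (((Real.hasDerivAt_rpow_const (p := 1 - m) (Or.inl hx.ne')).const_mul C).mul_const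
    K).add ((hasDerivAt_id x).div_const R)
  refine h.congr_deriv ?_
  rw [show 1 - m - 1 = -m by ring]
  ring

theorem rpow_neg_mul_rpow_self {d : ℝ} (hd : 0 < d) (m : ℝ) : d ^ (-m) * d ^ m = 1 := by
  rw [← Real.rpow_add hd]; simp

theorem rpow_one_sub_mul_rpow_self {d : ℝ} (hd : 0 < d) (m : ℝ) : d ^ (1 - m) * d ^ m = d := by
  rw [← Real.rpow_add hd]; simp

/-- A concave power function plus a linear one, below the threshold `d`. -/
theorem lower_branch_sub_mem_Icc {C m R d a b : ℝ} (hm : m < 0) (hd : 0 < d) (hC0 : C * (1 - m) ≤ 0)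
    (hC1 : 0 ≤ C * (1 - m) + 1 / R) (ha : 0 ≤ a) (hab : a ≤ b) (hbd : b ≤ d) :
    (C * b ^ (1 - m) * d ^ m + b / R) - (C * a ^ (1 - m) * d ^ m + a / R) ∈
      Icc 0 (1 / R * (b - a)) := by
  refine sub_mem_Icc_of_hasDerivAt (f := fun y => C * y ^ (1 - m) * d ^ m + y / R) hab ?_
    (fun x hx => hasDerivAt_mul_rpow_mul_add_div C m (d ^ m) R (ha.trans_lt hx.1)) ?_
  · have := Real.continuous_rpow_const (q := 1 - m) (by linarith)
    fun_prop
  · intro x hx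
    have hx0 : 0 < x := ha.trans_lt hx.1
    have h0 : 0 ≤ x ^ (-m) * d ^ m := by positivity
    have h1 : x ^ (-m) * d ^ m ≤ 1 := by
      rw [← rpow_neg_mul_rpow_self hd m]
      gcongr
      · linarith
      · exact hx.2.le.trans hbd
    constructor <;> nlinarith

/-- An increasing power function plus a constant, above the threshold `d`. -/
theorem upper_branch_sub_mem_Icc {B m K L d a b : ℝ} (hm : 0 < m) (hd : 0 < d)
    (hB : B * (1 - m) ∈ Icc 0 L) (hda : d ≤ a) (hab : a ≤ b) :
    (B * b ^ (1 - m) * d ^ m + K) - (B * a ^ (1 - m) * d ^ m + K) ∈ Icc 0 (L * (b - a)) := by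
  have hder : ∀ x, 0 < x → HasDerivAt (fun y : ℝ => B * y ^ (1 - m) * d ^ m + K)
      (B * (1 - m) * (x ^ (-m) * d ^ m)) x := fun x hx => by
    simpa using (hasDerivAt_mul_rpow_mul_add_div B m (d ^ m) 0 hx).add_const K
  refine sub_mem_Icc_of_hasDerivAt (f := fun y => B * y ^ (1 - m) * d ^ m + K) hab
    (fun x hx => (hder x (by linarith [hx.1])).continuousAt.continuousWithinAt)
    (fun x hx => hder x (by linarith [hx.1])) ?_
  intro x hx
  have hdx : d ≤ x := hda.trans hx.1.le
  have hx0 : 0 < x := hd.trans_le hdx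
  have h0 : 0 ≤ x ^ (-m) * d ^ m := by positivity
  have h1 : x ^ (-m) * d ^ m ≤ 1 := by
    rw [← rpow_neg_mul_rpow_self hd m]
    exact mul_le_mul_of_nonneg_right
      (Real.rpow_le_rpow_of_nonpos hd hdx (by linarith)) (by positivity)
  obtain ⟨hB0, hBL⟩ := hB
  constructor <;> nlinarith

/-- If g_b ≥ 0 and g_h + Zβ/(r+λ) ≤ 0, the strategy pair (0, θ_b) is a Nash
equilibrium of the installation game. -/
theorem stmt_15 (r lam mud sigd : ℝ) (hr : 0 < r) (hlam : 0 ≤ lam) (hsigd : 0 < sigd)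
    (hrd : 0 < r - mud - sigd ^ 2 / 2)
    (m1 m2 B1 C1 : ℝ)
    (hm1 : m1 = (-mud - Real.sqrt (mud ^ 2 + 2 * (r + lam) * sigd ^ 2)) / sigd ^ 2)
    (hm2 : m2 = (-mud + Real.sqrt (mud ^ 2 + 2 * (r + lam) * sigd ^ 2)) / sigd ^ 2)
    (hB1 : B1 = (m1 * mud + m1 * sigd ^ 2 / 2 - r - lam) /
        ((r + lam) * ((r - mud - sigd ^ 2 / 2) + lam) * (m2 - m1)))
    (hC1 : C1 = (m2 * mud + m2 * sigd ^ 2 / 2 - r - lam) /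
        ((r + lam) * ((r - mud - sigd ^ 2 / 2) + lam) * (m2 - m1)))
    (w : ℝ → ℝ → ℝ)
    (hw : ∀ y d : ℝ, w y d =
      if y = 0 then 0
      else if d < y then B1 * y ^ (1 - m2) * d ^ m2 + d / ((r - mud - sigd ^ 2 / 2) + lam)
      else C1 * y ^ (1 - m1) * d ^ m1 + y / (r + lam))
    (Z d θh θb β gh gb : ℝ) (hZ : 0 < Z) (hd : 0 < d) (hθh : 0 < θh) (hθb : 0 < θb)
    (hβ : β ∈ Set.Ioo (0 : ℝ) 1) (hgb : 0 ≤ gb) (hgh : gh + Z * β / (r + lam) ≤ 0) :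
    (∀ yh ∈ Icc (0 : ℝ) θh,
      gh * yh + β * Z * w (yh + θb) d ≤ β * Z * w θb d) ∧
    (∀ yb ∈ Icc (0 : ℝ) θb,
      gb * yb + (1 - β) * Z * w yb d ≤ gb * θb + (1 - β) * Z * w θb d) := by
  set R := r + lam with hR
  have hRpos : 0 < R := by linarith
  set D := r - mud - sigd ^ 2 / 2 + lam with hD
  have hDpos : 0 < D := by linarith
  have hs2 : 0 < sigd ^ 2 := by positivity
  set S := Real.sqrt (mud ^ 2 + 2 * R * sigd ^ 2) with hS
  have hSS : S ^ 2 = mud ^ 2 + 2 * R * sigd ^ 2 := Real.sq_sqrt (by positivity)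
  have hSpos : 0 < S := Real.sqrt_pos.2 (by positivity)
  have hRs : 0 < R * sigd ^ 2 := by positivity
  have hmS : |mud| < S := abs_lt_of_sq_lt_sq (by linarith) hSpos.le
  obtain ⟨hmS₁, hmS₂⟩ := abs_lt.1 hmS
  have hm1neg : m1 < 0 := by rw [hm1]; exact div_neg_of_neg_of_pos (by linarith) hs2
  have hm2pos : 0 < m2 := by rw [hm2]; exact div_pos (by linarith) hs2
  have hsum : sigd ^ 2 * (m1 + m2) = -2 * mud := by rw [hm1, hm2]; field_simp; ring
  have hprod : sigd ^ 2 * (m1 * m2) = -2 * R := by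
    rw [hm1, hm2]; field_simp; linear_combination -hSS
  have hgap : 0 < m2 - m1 := by linarith
  have hN1 : m1 * mud + m1 * sigd ^ 2 / 2 - r - lam = sigd ^ 2 / 2 * m1 * (1 - m1) := by
    linear_combination m1 / 2 * hsum - hprod / 2 + hR
  have hN2 : m2 * mud + m2 * sigd ^ 2 / 2 - r - lam = sigd ^ 2 / 2 * m2 * (1 - m2) := by
    linear_combination m2 / 2 * hsum - hprod / 2 + hR
  have hDm : D = -(sigd ^ 2 / 2 * (1 - m1) * (1 - m2)) := by
    linear_combination hD - hR - hsum / 2 + hprod / 2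
  have hB : B1 * (1 - m2) = -m1 / (R * (m2 - m1)) := by
    rw [hB1, hN1, div_mul_eq_mul_div, div_eq_div_iff (by positivity) (by positivity)]
    linear_combination m1 * R * (m2 - m1) * hDm
  have hC : C1 * (1 - m1) = -m2 / (R * (m2 - m1)) := by
    rw [hC1, hN2, div_mul_eq_mul_div, div_eq_div_iff (by positivity) (by positivity)]
    linear_combination m2 * R * (m2 - m1) * hDm
  have hfit : B1 + 1 / D = C1 + 1 / R := by
    have hBC : B1 - C1 = (D - R) / (R * D) := by
      rw [hB1, hC1, ← sub_div, div_eq_div_iff (by positivity) (by positivity)]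
      linear_combination -(m2 - m1) * R * D * (hD - hR)
    have hRD : 1 / R - 1 / D = (D - R) / (R * D) := by field_simp
    linear_combination hBC - hRD
  have hslope : -m1 / (R * (m2 - m1)) + m2 / (R * (m2 - m1)) = 1 / R := by
    field_simp
    ring
  have hpos₁ : 0 ≤ -m1 / (R * (m2 - m1)) := div_nonneg (by linarith) (by positivity)
  have hpos₂ : 0 ≤ m2 / (R * (m2 - m1)) := by positivity
  rw [neg_div] at hC
  have hlow : ∀ y, 0 ≤ y → y ≤ d → w y d = C1 * y ^ (1 - m1) * d ^ m1 + y / R := by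
    intro y hy hyd
    rw [hw]
    split_ifs with h0 h1
    · rw [h0, Real.zero_rpow (by linarith)]; simp
    · exact absurd h1 hyd.not_gt
    · rfl
  have hup : ∀ y, d ≤ y → w y d = B1 * y ^ (1 - m2) * d ^ m2 + d / D := by
    intro y hdy
    rcases hdy.eq_or_lt with rfl | hlt
    · rw [hlow d hd.le le_rfl, mul_assoc, mul_assoc, rpow_one_sub_mul_rpow_self hd,
        rpow_one_sub_mul_rpow_self hd]
      linear_combination -d * hfit
    · rw [hw, if_neg (hd.trans hlt).ne', if_pos hlt]
  have hlowSub : ∀ a b, 0 ≤ a → a ≤ b → b ≤ d → w b d - w a d ∈ Icc 0 (1 / R * (b - a)) := by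
    intro a b ha hab hbd
    rw [hlow b (ha.trans hab) hbd, hlow a ha (hab.trans hbd)]
    exact lower_branch_sub_mem_Icc hm1neg hd (by linarith) (by linarith) ha hab hbd
  have hupSub : ∀ a b, d ≤ a → a ≤ b → w b d - w a d ∈ Icc 0 (1 / R * (b - a)) := by
    intro a b hda hab
    rw [hup b (hda.trans hab), hup a hda]
    exact upper_branch_sub_mem_Icc hm2pos hd ⟨by linarith, by linarith⟩ hda hab
  have hsub : ∀ a b, 0 ≤ a → a ≤ b → w b d - w a d ∈ Icc 0 (1 / R * (b - a)) := by
    intro a b ha hab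
    rcases le_total b d with hbd | hdb
    · exact hlowSub a b ha hab hbd
    rcases le_total d a with hda | had
    · exact hupSub a b hda hab
    obtain ⟨h1, h2⟩ := hlowSub a d ha had le_rfl
    obtain ⟨h3, h4⟩ := hupSub d b le_rfl hdb
    exact ⟨by linarith, by linarith⟩
  obtain ⟨hβ0, hβ1⟩ := hβ
  constructor
  · rintro yh ⟨hyh, -⟩
    have h := (hsub θb (yh + θb) hθb.le (by linarith)).2
    rw [add_sub_cancel_right] at h
    have h1 := mul_le_mul_of_nonneg_left h (mul_pos hβ0 hZ).le
    have h2 := mul_nonpos_of_nonpos_of_nonneg hgh hyh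
    have h3 : Z * β / R * yh = β * Z * (1 / R * yh) := by ring
    linarith
  · rintro yb ⟨hyb, hybθ⟩
    have h := (hsub yb θb hyb hybθ).1
    have h1 := mul_nonneg (mul_pos (sub_pos.2 hβ1) hZ).le h
    have h2 := mul_le_mul_of_nonneg_left hybθ hgb
    linarith
end

section
/- Fix r > 0, λ ≥ 0, μ_d ∈ ℝ, σ_d > 0 with r_d := r − μ_d − σ_d²/2 > 0, define m₁, m₂, B₁, C₁ as in the incentive function, and fix Z > 0, d > 0, θ_h, θ_b > 0 with d < θ_h + θ_b, and net unit gains g_h < 0, g_b < 0. Set β_h := −g_h/(Z·B₁·(1−m₂)), β_b := 1 + g_b/(Z·B₁·(1−m₂)), and β_n := g_h/(g_h + g_b), and suppose β = β_n, g_h + Z·β_n/(r+λ) > 0, g_b + Z·(1−β_n)/(r+λ) > 0, and β_n ∈ (β_h, β_b). Then every pair (y_h*, y_b*) with y_h* ∈ [0, θ_h], y_b* ∈ (0, θ_b], and y_h* + y_b* = d·( Z·B₁·(m₂−1)/(g_h + g_b) )^{1/m₂} is a Nash equilibrium of the installation game with incentive share β = β_n. -/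
open Real Set

/-- Tangent-line inequality for power functions with exponent at least one. -/
lemma rpow_tangent_le_of_one_le {p x s : ℝ} (hp : 1 ≤ p) (hx : 0 ≤ x) (hs : 0 < s) :
    s ^ p * (1 + p * (x / s - 1)) ≤ x ^ p := by
  have h := one_add_mul_self_le_rpow_one_add (s := x / s - 1)
    (by linarith [div_nonneg hx hs.le]) hp
  rw [add_sub_cancel, Real.div_rpow hx hs.le, le_div_iff₀ (Real.rpow_pos_of_pos hs p)] at h
  linarith

/-- Tangent-line inequality for power functions with nonpositive exponent. -/
lemma rpow_tangent_le_of_nonpos {p x s : ℝ} (hp : p ≤ 0) (hx : 0 < x) (hs : 0 < s) :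
    s ^ p * (1 + p * (x / s - 1)) ≤ x ^ p := by
  have hxs : 0 < x / s := div_pos hx hs
  have h : 1 + p * (x / s - 1) ≤ (x / s) ^ p := by
    rw [Real.rpow_def_of_pos hxs]
    have h1 := Real.add_one_le_exp (Real.log (x / s) * p)
    have h2 := mul_le_mul_of_nonpos_right (Real.log_le_sub_one_of_pos hxs) hp
    linarith
  rw [Real.div_rpow hx.le hs.le, le_div_iff₀ (Real.rpow_pos_of_pos hs p)] at h
  linarith

/-- The incentive in the scarce regime lies below its tangent at any point. -/
lemma upper_branch_le_tangent {B m d s y : ℝ} (hB : B ≤ 0) (hm : 1 ≤ m) (hd : 0 < d)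
    (hs : 0 < s) (hy : 0 < y) :
    B * y ^ (1 - m) * d ^ m ≤
      B * s ^ (1 - m) * d ^ m + B * (1 - m) * (d / s) ^ m * (y - s) := by
  have h := rpow_tangent_le_of_nonpos (p := 1 - m) (by linarith) hy hs
  have h' := mul_le_mul_of_nonpos_left h
    (mul_nonpos_of_nonpos_of_nonneg hB (Real.rpow_nonneg hd.le m))
  have hsm : s ^ m ≠ 0 := (Real.rpow_pos_of_pos hs m).ne'
  refine le_of_eq_of_le (by ring) (h'.trans_eq ?_)
  rw [Real.div_rpow hd.le hs.le, Real.rpow_sub hs, Real.rpow_one]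
  field_simp

/-- The incentive in the abundant regime lies below its tangent at the switching point. -/
lemma lower_branch_le_tangent {C m d y : ℝ} (hC : C ≤ 0) (hm : m ≤ 0) (hd : 0 < d)
    (hy : 0 ≤ y) :
    C * y ^ (1 - m) * d ^ m ≤ C * d + C * (1 - m) * (y - d) := by
  have h := rpow_tangent_le_of_one_le (p := 1 - m) (by linarith) hy hd
  have h' := mul_le_mul_of_nonpos_left h
    (mul_nonpos_of_nonpos_of_nonneg hC (Real.rpow_nonneg hd.le m))
  have hdm : d ^ m ≠ 0 := (Real.rpow_pos_of_pos hd m).ne'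
  refine le_of_eq_of_le (by ring) (h'.trans_eq ?_)
  rw [Real.rpow_sub hd, Real.rpow_one]
  field_simp

/-- If the two branches match in value and slope at `y = d`, the incentive lies below its tangent
at any `s > d`. -/
lemma incentive_le_tangent {B C D R m₁ m₂ d s y : ℝ} (hB : B ≤ 0) (hC : C ≤ 0) (hm₁ : m₁ ≤ 0)
    (hm₂ : 1 ≤ m₂) (hval : B + 1 / D = C + 1 / R)
    (hslope : B * (1 - m₂) = C * (1 - m₁) + 1 / R) (hd : 0 < d) (hs : d < s) (hy : 0 ≤ y) :
    (if y = 0 then 0 else if d < y then B * y ^ (1 - m₂) * d ^ m₂ + d / D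
      else C * y ^ (1 - m₁) * d ^ m₁ + y / R) ≤
      B * s ^ (1 - m₂) * d ^ m₂ + d / D + B * (1 - m₂) * (d / s) ^ m₂ * (y - s) := by
  have hs0 : 0 < s := hd.trans hs
  by_cases hdy : d < y
  · rw [if_neg (hd.trans hdy).ne', if_pos hdy]
    linarith [upper_branch_le_tangent hB hm₂ hd hs0 (hd.trans hdy)]
  have hlower : (if y = 0 then 0 else if d < y then B * y ^ (1 - m₂) * d ^ m₂ + d / D
      else C * y ^ (1 - m₁) * d ^ m₁ + y / R) = C * y ^ (1 - m₁) * d ^ m₁ + y / R := by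
    split_ifs with h0
    · rw [h0, Real.zero_rpow (by linarith)]
      simp
    · rfl
  rw [hlower]
  have h₁ := lower_branch_le_tangent hC hm₁ hd hy
  have h₂ := upper_branch_le_tangent hB hm₂ hd hs0 hd
  have hdd : d ^ (1 - m₂) * d ^ m₂ = d := by
    rw [← Real.rpow_add hd, sub_add_cancel, Real.rpow_one]
  rw [mul_assoc B, hdd] at h₂
  have hk : B * (1 - m₂) * (d / s) ^ m₂ ≤ B * (1 - m₂) :=
    mul_le_of_le_one_right (mul_nonneg_of_nonpos_of_nonpos hB (by linarith))
      (Real.rpow_le_one (by positivity) ((div_le_one hs0).2 hs.le) (by linarith))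
  have h₃ : B * (1 - m₂) * (y - d) ≤ B * (1 - m₂) * (d / s) ^ m₂ * (y - d) :=
    mul_le_mul_of_nonpos_right hk (by linarith)
  have h₄ : B * d + d / D = C * d + d / R := by linear_combination d * hval
  have h₅ : B * (1 - m₂) * (y - d) = C * (1 - m₁) * (y - d) + y / R - d / R := by
    linear_combination (y - d) * hslope
  linarith

/-- The characteristic roots satisfy `m₁ < 0` and `1 < m₂`, and both solve the characteristic
equation. -/
lemma characteristic_roots_s16 {R mu sig m₁ m₂ : ℝ} (hR : 0 < R) (hsig : 0 < sig)
    (hD : 0 < R - mu - sig ^ 2 / 2)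
    (hm₁ : m₁ = (-mu - Real.sqrt (mu ^ 2 + 2 * R * sig ^ 2)) / sig ^ 2)
    (hm₂ : m₂ = (-mu + Real.sqrt (mu ^ 2 + 2 * R * sig ^ 2)) / sig ^ 2) :
    m₁ < 0 ∧ 1 < m₂ ∧ m₁ * mu + m₁ ^ 2 * sig ^ 2 / 2 = R ∧
      m₂ * mu + m₂ ^ 2 * sig ^ 2 / 2 = R := by
  have hpos : 0 < sig ^ 2 := by positivity
  have hq : 0 < R * sig ^ 2 := by positivity
  set q := Real.sqrt (mu ^ 2 + 2 * R * sig ^ 2) with hqdef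
  have hsq : q ^ 2 = mu ^ 2 + 2 * R * sig ^ 2 := Real.sq_sqrt (by nlinarith [sq_nonneg mu])
  refine ⟨?_, ?_, ?_, ?_⟩
  · rw [hm₁, div_neg_iff]
    have : -mu < q := Real.lt_sqrt_of_sq_lt (by nlinarith)
    exact Or.inr ⟨by linarith, hpos⟩
  · rw [hm₂, one_lt_div hpos]
    have : sig ^ 2 + mu < q := Real.lt_sqrt_of_sq_lt (by nlinarith)
    linarith
  · rw [hm₁]
    field_simp
    linear_combination hsq
  · rw [hm₂]
    field_simp
    linear_combination hsq

/-- Sign and smooth-fit conditions for the incentive coefficients. -/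
lemma incentive_coefficients {R mu sig m₁ m₂ B C : ℝ} (hR : 0 < R) (hsig : 0 < sig)
    (hD : 0 < R - mu - sig ^ 2 / 2) (h₁ : m₁ < 0) (h₂ : 1 < m₂)
    (hc₁ : m₁ * mu + m₁ ^ 2 * sig ^ 2 / 2 = R) (hc₂ : m₂ * mu + m₂ ^ 2 * sig ^ 2 / 2 = R)
    (hB : B = (m₁ * mu + m₁ * sig ^ 2 / 2 - R) / (R * (R - mu - sig ^ 2 / 2) * (m₂ - m₁)))
    (hC : C = (m₂ * mu + m₂ * sig ^ 2 / 2 - R) / (R * (R - mu - sig ^ 2 / 2) * (m₂ - m₁))) :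
    B < 0 ∧ C < 0 ∧ B + 1 / (R - mu - sig ^ 2 / 2) = C + 1 / R ∧
      B * (1 - m₂) = C * (1 - m₁) + 1 / R := by
  have hm : 0 < m₂ - m₁ := by linarith
  have hpos : 0 < sig ^ 2 := by positivity
  have hden : 0 < R * (R - mu - sig ^ 2 / 2) * (m₂ - m₁) := by positivity
  have hD' := hD.ne'
  have hR' := hR.ne'
  have hm' := hm.ne'
  obtain ⟨D, hDdef⟩ : ∃ D, D = R - mu - sig ^ 2 / 2 := ⟨_, rfl⟩
  rw [← hDdef] at hB hC hden hD' ⊢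
  refine ⟨?_, ?_, ?_, ?_⟩
  · rw [hB]
    refine div_neg_of_neg_of_pos ?_ hden
    have : m₁ * (1 - m₁) * sig ^ 2 < 0 :=
      mul_neg_of_neg_of_pos (mul_neg_of_neg_of_pos h₁ (by linarith)) hpos
    linarith
  · rw [hC]
    refine div_neg_of_neg_of_pos ?_ hden
    have : m₂ * (1 - m₂) * sig ^ 2 < 0 :=
      mul_neg_of_neg_of_pos (mul_neg_of_pos_of_neg (by linarith) (by linarith)) hpos
    linarith
  · rw [hB, hC]
    field_simp
    rw [hDdef]
    ring
  · rw [hB, hC]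
    field_simp
    rw [hDdef]
    ring

/-- In the case g_h < 0, g_b < 0 with β = β_n := g_h/(g_h+g_b) ∈ (β_h, β_b),
g_h + Zβ_n/(r+λ) > 0 and g_b + Z(1−β_n)/(r+λ) > 0, every pair (y_h*, y_b*) with
y_h* ∈ [0,θ_h], y_b* ∈ (0,θ_b] and y_h* + y_b* = d·(Z B₁ (m₂−1)/(g_h+g_b))^{1/m₂}
is a Nash equilibrium of the installation game. -/
theorem stmt_16 (r lam mud sigd : ℝ) (hr : 0 < r) (hlam : 0 ≤ lam) (hsigd : 0 < sigd)
    (hrd : 0 < r - mud - sigd ^ 2 / 2)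
    (m1 m2 B1 C1 : ℝ)
    (hm1 : m1 = (-mud - Real.sqrt (mud ^ 2 + 2 * (r + lam) * sigd ^ 2)) / sigd ^ 2)
    (hm2 : m2 = (-mud + Real.sqrt (mud ^ 2 + 2 * (r + lam) * sigd ^ 2)) / sigd ^ 2)
    (hB1 : B1 = (m1 * mud + m1 * sigd ^ 2 / 2 - r - lam) /
        ((r + lam) * ((r - mud - sigd ^ 2 / 2) + lam) * (m2 - m1)))
    (hC1 : C1 = (m2 * mud + m2 * sigd ^ 2 / 2 - r - lam) /
        ((r + lam) * ((r - mud - sigd ^ 2 / 2) + lam) * (m2 - m1)))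
    (w : ℝ → ℝ → ℝ)
    (hw : ∀ y d : ℝ, w y d =
      if y = 0 then 0
      else if d < y then B1 * y ^ (1 - m2) * d ^ m2 + d / ((r - mud - sigd ^ 2 / 2) + lam)
      else C1 * y ^ (1 - m1) * d ^ m1 + y / (r + lam))
    (Z d θh θb gh gb : ℝ) (hZ : 0 < Z) (hd : 0 < d) (hθh : 0 < θh) (hθb : 0 < θb)
    (hdsum : d < θh + θb) (hgh : gh < 0) (hgb : gb < 0)
    (βh βb βn : ℝ)
    (hβh : βh = -gh / (Z * B1 * (1 - m2)))
    (hβb : βb = 1 + gb / (Z * B1 * (1 - m2)))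
    (hβn : βn = gh / (gh + gb))
    (hgh2 : 0 < gh + Z * βn / (r + lam))
    (hgb2 : 0 < gb + Z * (1 - βn) / (r + lam))
    (hβnmem : βn ∈ Set.Ioo βh βb) :
    ∀ yh yb : ℝ, yh ∈ Icc (0 : ℝ) θh → yb ∈ Ioc (0 : ℝ) θb →
      yh + yb = d * (Z * B1 * (m2 - 1) / (gh + gb)) ^ (1 / m2) →
      (∀ yh' ∈ Icc (0 : ℝ) θh,
        gh * yh' + βn * Z * w (yh' + yb) d ≤ gh * yh + βn * Z * w (yh + yb) d) ∧
      (∀ yb' ∈ Icc (0 : ℝ) θb,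
        gb * yb' + (1 - βn) * Z * w (yh + yb') d ≤ gb * yb + (1 - βn) * Z * w (yh + yb) d) := by
  intro yh yb hyh hyb hsum
  set s := yh + yb with hsdef
  have hR : 0 < r + lam := by linarith
  have hDeq : r - mud - sigd ^ 2 / 2 + lam = r + lam - mud - sigd ^ 2 / 2 := by ring
  rw [hDeq] at hB1 hC1
  rw [sub_sub _ r lam] at hB1 hC1
  simp only [hDeq] at hw
  have hD : 0 < r + lam - mud - sigd ^ 2 / 2 := by linarith
  obtain ⟨h₁, h₂, hc₁, hc₂⟩ := characteristic_roots_s16 hR hsigd hD hm1 hm2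
  obtain ⟨hB, hC, hval, hslope⟩ := incentive_coefficients hR hsigd hD h₁ h₂ hc₁ hc₂ hB1 hC1
  have hg : gh + gb < 0 := by linarith
  have hk : 0 < Z * B1 * (1 - m2) :=
    mul_pos_of_neg_of_neg (mul_neg_of_pos_of_neg hZ hB) (by linarith)
  have hlt : -(gh + gb) < Z * B1 * (1 - m2) := by
    have h := hβnmem.1
    rw [hβh, hβn, ← neg_div_neg_eq gh, div_lt_div_iff_of_pos_left (by linarith) hk
      (by linarith)] at h
    exact h
  set a := Z * B1 * (m2 - 1) / (gh + gb) with ha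
  have ha1 : 1 < a := by
    rw [ha, ← neg_div_neg_eq, one_lt_div (by linarith)]
    linarith
  have hds : d < s := by
    rw [hsum]
    exact lt_mul_of_one_lt_right hd (Real.one_lt_rpow ha1 (by positivity))
  have hs0 : 0 < s := hd.trans hds
  have hratio : Z * (B1 * (1 - m2) * (d / s) ^ m2) = -(gh + gb) := by
    have hsd : (s / d) ^ m2 = a := by
      rw [hsum, mul_div_cancel_left₀ _ hd.ne', ← Real.rpow_mul (by linarith),
        one_div_mul_cancel (by linarith), Real.rpow_one]
    rw [← inv_div, Real.inv_rpow (by positivity), hsd, ha, inv_div]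
    have hB' := hB.ne
    have hm' : m2 - 1 ≠ 0 := by linarith
    field_simp
    ring
  have hopt : ∀ y, 0 ≤ y → Z * w y d ≤ Z * w s d - (gh + gb) * (y - s) := by
    intro y hy
    have h := mul_le_mul_of_nonneg_left
      (incentive_le_tangent hB.le hC.le h₁.le h₂.le hval hslope hd hds hy) hZ.le
    rw [← hw, mul_add, ← mul_assoc Z _ (y - s), hratio] at h
    rw [hw s d, if_neg hs0.ne', if_pos hds]
    linarith
  have hβpos : 0 ≤ βn := hβn ▸ (div_pos_of_neg_of_neg hgh hg).le
  have hβg : βn * (gh + gb) = gh := by rw [hβn, div_mul_cancel₀ _ hg.ne]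
  have hβg' : (1 - βn) * (gh + gb) = gb := by linear_combination -hβg
  have hβpos' : 0 ≤ 1 - βn := by
    rw [← mul_div_cancel_right₀ (1 - βn) hg.ne, hβg']
    exact (div_pos_of_neg_of_neg hgb hg).le
  constructor
  · intro y hy
    have h := mul_le_mul_of_nonneg_left (hopt (y + yb) (by linarith [hy.1, hyb.1])) hβpos
    linear_combination h - (y - yh) * hβg
  · intro y hy
    have h := mul_le_mul_of_nonneg_left (hopt (yh + y) (by linarith [hy.1, hyh.1])) hβpos'
    linear_combination h - (y - yb) * hβg'
end
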